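/- arXiv:2103.06668 — 3 statements merged into one kernel-verified Lean document; each statement's English description precedes it below -/
import Mathlib

section
/- Modulated energy–dissipation identity (Lemma 3.8, classical form): let ε, γ, σ > 0 and T > 0, and let (u, p, f) be a classical solution of the scaled Vlasov–Navier–Stokes system with parameters ε, γ, σ on [0,T], and assume ρ̄ := ∫_{𝕋³×ℝ³} f(0,x,v) dx dv > 0. Then the modulated energy 𝓔 is differentiable on [0,T] and 𝓔′(t) + D(t) = 0 for every t ∈ [0,T]; in particular 𝓔(t) + ∫ₛᵗ D(τ) dτ = 𝓔(s) for all 0 ≤ s ≤ t ≤ T. -/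
noncomputable section

open MeasureTheory Real

/-- Euclidean three-dimensional space, in which both positions and velocities live. -/
abbrev E3 : Type := EuclideanSpace ℝ (Fin 3)

/-- The `i`-th vector of the standard basis of `E3`. -/
def e3 (i : Fin 3) : E3 := EuclideanSpace.single i 1

/-- The fundamental cube `[0, 2π]³` of the torus `𝕋³ = ℝ³/(2πℤ)³`. -/
def cube3 : Set E3 := {x : E3 | ∀ i, x i ∈ Set.Icc (0 : ℝ) (2 * π)}

/-- Normalized integral over the torus `𝕋³` of a (`2π`-periodic) scalar function:
`∫_{𝕋³} g dx := (2π)⁻³ ∫_{[0,2π]³} g(x) dx`. -/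
def intT3 (g : E3 → ℝ) : ℝ := ((2 * π) ^ 3)⁻¹ * ∫ x in cube3, g x

/-- Normalized integral over the torus `𝕋³` of a vector-valued function. -/
def intT3V (g : E3 → E3) : E3 := ((2 * π) ^ 3)⁻¹ • ∫ x in cube3, g x

/-- Kinetic density `ρ_f(t,x) := ∫_{ℝ³} f(t,x,v) dv`. -/
def kdens (f : ℝ → E3 → E3 → ℝ) (t : ℝ) (x : E3) : ℝ := ∫ v : E3, f t x v

/-- Kinetic momentum `j_f(t,x) := (1/σ) ∫_{ℝ³} v f(t,x,v) dv`. -/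
def kmom (σ : ℝ) (f : ℝ → E3 → E3 → ℝ) (t : ℝ) (x : E3) : E3 :=
  σ⁻¹ • ∫ v : E3, f t x v • v

/-- A classical solution of the scaled Vlasov–Navier–Stokes system with parameters
`ε, γ, σ > 0` on the time interval `[0,T]`:  `u` is the fluid velocity (`C¹` in time,
`C²` in space, `2π`-periodic in each space coordinate, divergence free), `p` is the
pressure (continuous, `C¹` in space, periodic) and `f` is the nonnegative distribution
function (`C¹`, periodic in `x`, vanishing for `|v| ≥ R₀`), satisfying pointwise the
momentum equation `∂ₜu + (u·∇ₓ)u − Δₓu + ∇ₓp = (1/γ)(j_f − ρ_f u)` and the Vlasov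
equation `∂ₜf + (1/σ) v·∇ₓf + (1/ε) div_v[f(σu − v)] = 0`. -/
structure IsClassicalVNS (ε γ σ T : ℝ) (u : ℝ → E3 → E3) (p : ℝ → E3 → ℝ)
    (f : ℝ → E3 → E3 → ℝ) : Prop where
  /-- `u` is (jointly) `C¹` in time on `[0,T] × ℝ³`. -/
  u_reg_t : ContDiffOn ℝ 1 (fun q : ℝ × E3 => u q.1 q.2) (Set.Icc 0 T ×ˢ Set.univ)
  /-- `u` is `C²` in the space variable. -/
  u_reg_x : ∀ t ∈ Set.Icc (0:ℝ) T, ContDiff ℝ 2 (u t)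
  /-- `u` is `2π`-periodic in each space coordinate. -/
  u_periodic : ∀ t ∈ Set.Icc (0:ℝ) T, ∀ (x : E3) (i : Fin 3),
    u t (x + (2 * π) • e3 i) = u t x
  /-- `u` is divergence free: `divₓ u = 0`. -/
  u_div_free : ∀ t ∈ Set.Icc (0:ℝ) T, ∀ x : E3,
    ∑ i, fderiv ℝ (fun y => u t y i) x (e3 i) = 0
  /-- `p` is continuous on `[0,T] × ℝ³`. -/
  p_cont : ContinuousOn (fun q : ℝ × E3 => p q.1 q.2) (Set.Icc 0 T ×ˢ Set.univ)
  /-- `p` is `C¹` in the space variable. -/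
  p_reg_x : ∀ t ∈ Set.Icc (0:ℝ) T, ContDiff ℝ 1 (p t)
  /-- `p` is `2π`-periodic in each space coordinate. -/
  p_periodic : ∀ t ∈ Set.Icc (0:ℝ) T, ∀ (x : E3) (i : Fin 3),
    p t (x + (2 * π) • e3 i) = p t x
  /-- `f` is nonnegative. -/
  f_nonneg : ∀ t ∈ Set.Icc (0:ℝ) T, ∀ (x v : E3), 0 ≤ f t x v
  /-- `f` is `C¹` on `[0,T] × ℝ³ × ℝ³`. -/
  f_reg : ContDiffOn ℝ 1 (fun q : ℝ × E3 × E3 => f q.1 q.2.1 q.2.2)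
    (Set.Icc 0 T ×ˢ (Set.univ : Set (E3 × E3)))
  /-- `f` is `2π`-periodic in each space coordinate. -/
  f_periodic : ∀ t ∈ Set.Icc (0:ℝ) T, ∀ (x v : E3) (i : Fin 3),
    f t (x + (2 * π) • e3 i) v = f t x v
  /-- `f` vanishes for large velocities: `f(t,x,v) = 0` whenever `|v| ≥ R₀`. -/
  f_compact_supp : ∃ R₀ > (0:ℝ), ∀ t ∈ Set.Icc (0:ℝ) T, ∀ (x v : E3),
    R₀ ≤ ‖v‖ → f t x v = 0
  /-- The momentum (Navier–Stokes) equation, componentwise: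
  `∂ₜuᵢ + Σⱼ uⱼ ∂ⱼuᵢ − Δₓuᵢ + ∂ᵢp = (1/γ)((j_f)ᵢ − ρ_f uᵢ)`. -/
  navier_stokes : ∀ t ∈ Set.Icc (0:ℝ) T, ∀ (x : E3) (i : Fin 3),
    derivWithin (fun s => u s x i) (Set.Icc 0 T) t
      + ∑ j, u t x j * fderiv ℝ (fun y => u t y i) x (e3 j)
      - ∑ j, fderiv ℝ (fun y => fderiv ℝ (fun z => u t z i) y (e3 j)) x (e3 j)
      + fderiv ℝ (p t) x (e3 i)
      = γ⁻¹ * (kmom σ f t x i - kdens f t x * u t x i)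
  /-- The Vlasov equation:
  `∂ₜf + (1/σ) v·∇ₓf + (1/ε) div_v[f(σu − v)] = 0`. -/
  vlasov : ∀ t ∈ Set.Icc (0:ℝ) T, ∀ (x v : E3),
    derivWithin (fun s => f s x v) (Set.Icc 0 T) t
      + σ⁻¹ * ∑ i, v i * fderiv ℝ (fun y => f t y v) x (e3 i)
      + ε⁻¹ * ∑ i, fderiv ℝ (fun w => f t x w * (σ * u t x i - w i)) v (e3 i) = 0

/-- Total mass `ρ̄(t) := ∫_{𝕋³×ℝ³} f(t,x,v) dx dv`. -/
def totalMass (f : ℝ → E3 → E3 → ℝ) (t : ℝ) : ℝ := intT3 (fun x => ∫ v : E3, f t x v)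

/-- Mean momentum `⟨j⟩(t) := ∫_{𝕋³} j_f(t,x) dx = (1/σ) ∫_{𝕋³×ℝ³} v f(t,x,v) dx dv`. -/
def meanMomentum (σ : ℝ) (f : ℝ → E3 → E3 → ℝ) (t : ℝ) : E3 := intT3V (kmom σ f t)

/-- Mean fluid velocity `⟨u⟩(t) := ∫_{𝕋³} u(t,x) dx`. -/
def meanVelocity (u : ℝ → E3 → E3) (t : ℝ) : E3 := intT3V (u t)

/-- The modulated energy
`𝓔(t) := (ε/(2γ)) ∫_{𝕋³×ℝ³} |v/σ − ⟨j⟩(t)/ρ̄|² f dx dv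
        + (1/2) ∫_{𝕋³} |u(t,x) − ⟨u⟩(t)|² dx
        + (ε ρ̄/(2(γ + ε ρ̄))) |⟨j⟩(t)/ρ̄ − ⟨u⟩(t)|²`. -/
def modulatedEnergy (ε γ σ : ℝ) (u : ℝ → E3 → E3) (f : ℝ → E3 → E3 → ℝ) (t : ℝ) : ℝ :=
  ε / (2 * γ) * intT3 (fun x => ∫ v : E3,
      ‖σ⁻¹ • v - (totalMass f t)⁻¹ • meanMomentum σ f t‖ ^ 2 * f t x v)
    + 1 / 2 * intT3 (fun x => ‖u t x - meanVelocity u t‖ ^ 2)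
    + ε * totalMass f t / (2 * (γ + ε * totalMass f t)) *
        ‖(totalMass f t)⁻¹ • meanMomentum σ f t - meanVelocity u t‖ ^ 2

/-- The scaled dissipation
`D(t) := ∫_{𝕋³} |∇ₓu(t,x)|² dx + (1/γ) ∫_{𝕋³×ℝ³} |v/σ − u(t,x)|² f(t,x,v) dx dv`. -/
def dissipationVNS (γ σ : ℝ) (u : ℝ → E3 → E3) (f : ℝ → E3 → E3 → ℝ) (t : ℝ) : ℝ :=
  intT3 (fun x => ∑ i, ∑ j, (fderiv ℝ (fun y => u t y i) x (e3 j)) ^ 2)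
    + γ⁻¹ * intT3 (fun x => ∫ v : E3, ‖σ⁻¹ • v - u t x‖ ^ 2 * f t x v)

/-- A function that is `C¹` on `[0,T] × X` has a time derivative which is jointly continuous. -/
lemma exists_continuousOn_timeDeriv {X : Type*} [NormedAddCommGroup X] [NormedSpace ℝ X]
    {T : ℝ} (hT : 0 < T) {F : ℝ × X → ℝ}
    (hF : ContDiffOn ℝ 1 F (Set.Icc 0 T ×ˢ Set.univ)) :
    ContinuousOn (fun q : ℝ × X => derivWithin (fun s => F (s, q.2)) (Set.Icc 0 T) q.1)
        (Set.Icc 0 T ×ˢ Set.univ) ∧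
      ∀ t ∈ Set.Icc (0:ℝ) T, ∀ x, HasDerivWithinAt (fun s => F (s, x))
        (derivWithin (fun s => F (s, x)) (Set.Icc 0 T) t) (Set.Icc 0 T) t := by
  have hud : UniqueDiffOn ℝ (Set.Icc (0:ℝ) T ×ˢ (Set.univ : Set X)) :=
    (uniqueDiffOn_Icc hT).prod uniqueDiffOn_univ
  have key : ∀ t ∈ Set.Icc (0:ℝ) T, ∀ x : X, HasDerivWithinAt (fun s => F (s, x))
      (fderivWithin ℝ F (Set.Icc 0 T ×ˢ Set.univ) (t, x) (1, 0)) (Set.Icc 0 T) t := by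
    intro t ht x
    have h1 : HasFDerivWithinAt F (fderivWithin ℝ F (Set.Icc 0 T ×ˢ Set.univ) (t, x))
        (Set.Icc 0 T ×ˢ Set.univ) (t, x) :=
      (hF.differentiableOn (by norm_num) (t, x) ⟨ht, trivial⟩).hasFDerivWithinAt
    have h2 : HasDerivWithinAt (fun s : ℝ => (s, x)) ((1 : ℝ), (0 : X)) (Set.Icc 0 T) t :=
      (hasDerivWithinAt_id t _).prodMk (hasDerivWithinAt_const t _ x)
    exact HasFDerivWithinAt.comp_hasDerivWithinAt t h1 h2 (fun s hs => ⟨hs, trivial⟩)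
  refine ⟨?_, fun t ht x => (key t ht x).differentiableWithinAt.hasDerivWithinAt⟩
  have hc : ContinuousOn (fun q => fderivWithin ℝ F (Set.Icc 0 T ×ˢ Set.univ) q ((1 : ℝ), (0 : X)))
      (Set.Icc 0 T ×ˢ Set.univ) :=
    (hF.continuousOn_fderivWithin hud le_rfl).clm_apply continuousOn_const
  exact hc.congr fun q hq => (key q.1 hq.1 q.2).derivWithin (uniqueDiffOn_Icc hT _ hq.1)

/-- Differentiation under the integral sign over a compact set, up to the end points of the
time interval. -/
lemma hasDerivWithinAt_setIntegral_of_contDiffOn {X : Type*} [NormedAddCommGroup X]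
    [NormedSpace ℝ X] [MeasurableSpace X] [BorelSpace X] {μ : Measure X}
    [IsFiniteMeasureOnCompacts μ] {K : Set X} (hK : IsCompact K)
    {T : ℝ} (hT : 0 < T) {F : ℝ × X → ℝ}
    (hF : ContDiffOn ℝ 1 F (Set.Icc 0 T ×ˢ Set.univ)) {t : ℝ} (ht : t ∈ Set.Icc (0:ℝ) T) :
    HasDerivWithinAt (fun s => ∫ x in K, F (s, x) ∂μ)
      (∫ x in K, derivWithin (fun s => F (s, x)) (Set.Icc 0 T) t ∂μ) (Set.Icc 0 T) t := by
  obtain ⟨hc, hd⟩ := exists_continuousOn_timeDeriv hT hF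
  obtain ⟨C, hC⟩ := (isCompact_Icc.prod hK).exists_bound_of_continuousOn
    (hc.mono (Set.prod_mono_right (Set.subset_univ K)))
  have hint : ∀ s ∈ Set.Icc (0:ℝ) T, IntegrableOn (fun x => F (s, x)) K μ := by
    intro s hs
    refine ContinuousOn.integrableOn_compact hK ?_
    exact hF.continuousOn.comp (by fun_prop) (fun x _ => ⟨hs, trivial⟩)
  have hlip : ∀ s ∈ Set.Icc (0:ℝ) T, ∀ x ∈ K, ‖F (s, x) - F (t, x)‖ ≤ C * ‖s - t‖ := by
    intro s hs x hx
    exact (convex_Icc (0:ℝ) T).norm_image_sub_le_of_norm_hasDerivWithin_le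
      (f := fun s => F (s, x)) (fun r hr => hd r hr x) (fun r hr => hC (r, x) ⟨hr, hx⟩) ht hs
  have : IsFiniteMeasure (μ.restrict K) := ⟨by simpa using hK.measure_lt_top⟩
  have hmem : ∀ᶠ s in nhdsWithin t (Set.Icc 0 T \ {t}), s ∈ Set.Icc 0 T \ {t} :=
    eventually_mem_nhdsWithin
  rw [hasDerivWithinAt_iff_tendsto_slope]
  have hlim : Filter.Tendsto (fun s => ∫ x in K, slope (fun r => F (r, x)) t s ∂μ)
      (nhdsWithin t (Set.Icc 0 T \ {t}))
      (nhds (∫ x in K, derivWithin (fun s => F (s, x)) (Set.Icc 0 T) t ∂μ)) := by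
    refine tendsto_integral_filter_of_dominated_convergence (fun _ => C) ?_ ?_
      (integrable_const C) ?_
    · filter_upwards [hmem] with s hs
      simp only [slope_def_field]
      exact (((hint s hs.1).sub (hint t ht)).div_const _).aestronglyMeasurable
    · filter_upwards [hmem] with s hs
      filter_upwards [ae_restrict_mem hK.measurableSet] with x hx
      have hne : 0 < ‖s - t‖ := norm_pos_iff.2 (sub_ne_zero.2 hs.2)
      rw [slope_def_field, norm_div, div_le_iff₀ hne]
      exact hlip s hs.1 x hx
    · exact Filter.Eventually.of_forall fun x =>
        hasDerivWithinAt_iff_tendsto_slope.1 (hd t ht x)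
  refine hlim.congr' ?_
  filter_upwards [hmem] with s hs
  simp only [slope_def_field]
  rw [integral_div, integral_sub (hint s hs.1) (hint t ht)]

lemma toLp_preimage_cube3 : (WithLp.toLp 2 : (Fin 3 → ℝ) → E3) ⁻¹' cube3
    = Set.Icc (0 : Fin 3 → ℝ) (fun _ => 2 * π) := by
  ext x
  simp only [cube3, Set.mem_preimage, Set.mem_ofPred_eq, Set.mem_Icc, Pi.le_def]
  exact ⟨fun h => ⟨fun i => (h i).1, fun i => (h i).2⟩, fun h i => ⟨h.1 i, h.2 i⟩⟩

lemma isCompact_cube3 : IsCompact cube3 := by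
  have : cube3 = (PiLp.continuousLinearEquiv 2 ℝ (fun _ : Fin 3 => ℝ)).symm ''
      Set.Icc (0 : Fin 3 → ℝ) (fun _ => 2 * π) := by
    ext x
    simp only [cube3, Set.mem_ofPred_eq, Set.mem_Icc, Pi.le_def, Set.mem_image]
    constructor
    · exact fun h => ⟨fun i => x i, ⟨fun i => (h i).1, fun i => (h i).2⟩, rfl⟩
    · rintro ⟨y, hy, rfl⟩ i
      exact ⟨hy.1 i, hy.2 i⟩
  rw [this]
  exact isCompact_Icc.image (ContinuousLinearEquiv.continuous _)

lemma Continuous.integrableOn_cube3 {g : E3 → ℝ} (hg : Continuous g) : IntegrableOn g cube3 :=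
  hg.continuousOn.integrableOn_compact isCompact_cube3

/-- The integral over a period of a partial derivative of a periodic `C¹` function vanishes. -/
lemma setIntegral_cube3_fderiv_eq_zero {g : E3 → ℝ} (hg : ContDiff ℝ 1 g)
    (hper : ∀ (x : E3) (i : Fin 3), g (x + (2 * π) • e3 i) = g x) (j : Fin 3) :
    ∫ x in cube3, fderiv ℝ g x (e3 j) = 0 := by
  have hmp := PiLp.volume_preserving_toLp (Fin 3)
  have hme : MeasurableEmbedding (WithLp.toLp 2 : (Fin 3 → ℝ) → E3) :=
    (MeasurableEquiv.toLp 2 (Fin 3 → ℝ)).measurableEmbedding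
  rw [← hmp.setIntegral_preimage_emb hme (fun x => fderiv ℝ g x (e3 j)) cube3]
  set L : (Fin 3 → ℝ) →L[ℝ] E3 :=
    ((PiLp.continuousLinearEquiv 2 ℝ (fun _ : Fin 3 => ℝ)).symm : (Fin 3 → ℝ) →L[ℝ] E3) with hL
  have hLx : ∀ x, L x = WithLp.toLp 2 x := fun x => rfl
  rw [toLp_preimage_cube3]
  have hdiv := integral_divergence_of_hasFDerivAt_off_countable (E := ℝ) (n := 2)
    (0 : Fin 3 → ℝ) (fun _ => 2 * π) (fun i => by simp [Real.pi_pos.le])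
    (fun x => Pi.single j (g (L x)))
    (fun x => (ContinuousLinearMap.single ℝ (fun _ : Fin 3 => ℝ) j).comp ((fderiv ℝ g (L x)).comp L))
    ∅ Set.countable_empty ?_ ?_ ?_
  · have h1 : ∀ x : Fin 3 → ℝ, ∑ i, ((ContinuousLinearMap.single ℝ (fun _ : Fin 3 => ℝ) j).comp
        ((fderiv ℝ g (L x)).comp L)) (Pi.single i 1) i = fderiv ℝ g (WithLp.toLp 2 x) (e3 j) := by
      intro x
      rw [Finset.sum_eq_single j]
      · simp [hLx, e3]
      · intro b _ hb
        simp [hb]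
      · simp
    simp only [h1] at hdiv
    rw [hdiv, Finset.sum_eq_single j]
    · rw [sub_eq_zero]
      congr 1
      ext x
      simp only [Pi.single_eq_same]
      rw [← hper (L (j.insertNth ((0 : Fin 3 → ℝ) j) x)) j]
      congr 1
      ext i
      refine Fin.succAboveCases j ?_ (fun k => ?_) i
      · simp [hLx, e3]
      · simp [hLx, e3]
    · intro b _ hb
      simp [hb]
    · simp
  · have : Continuous fun x => g (L x) := hg.continuous.comp L.continuous
    exact (continuous_pi fun i => by
      by_cases h : i = j
      · subst h; simpa using this
      · simp only [Pi.single_apply, h, if_false]; exact continuous_const).continuousOn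
  · intro x _
    have h2 : HasFDerivAt (fun x => g (L x)) ((fderiv ℝ g (L x)).comp L) x :=
      ((hg.differentiable (by norm_num) (L x)).hasFDerivAt).comp x L.hasFDerivAt
    exact ((ContinuousLinearMap.single ℝ (fun _ : Fin 3 => ℝ) j).hasFDerivAt).comp x h2
  · refine ContinuousOn.integrableOn_compact isCompact_Icc (Continuous.continuousOn ?_)
    have : Continuous fun x => fderiv ℝ g (L x) :=
      (hg.continuous_fderiv (by norm_num)).comp L.continuous
    have h3 : Continuous fun x => (ContinuousLinearMap.single ℝ (fun _ : Fin 3 => ℝ) j).comp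
        ((fderiv ℝ g (L x)).comp L) :=
      continuous_const.clm_comp (this.clm_comp continuous_const)
    exact continuous_finsetSum _ fun i _ =>
      (continuous_apply i).comp (h3.clm_apply continuous_const)

lemma intT3_const (c : ℝ) : intT3 (fun _ => c) = c := by
  have hmp := PiLp.volume_preserving_toLp (Fin 3)
  have hme : MeasurableEmbedding (WithLp.toLp 2 : (Fin 3 → ℝ) → E3) :=
    (MeasurableEquiv.toLp 2 (Fin 3 → ℝ)).measurableEmbedding
  rw [intT3, ← hmp.setIntegral_preimage_emb hme (fun _ => c) cube3, toLp_preimage_cube3, setIntegral_const,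
    measureReal_def, Real.volume_Icc_pi_toReal (fun i => by simp [Real.pi_pos.le])]
  have := Real.pi_pos
  simp

/-- Integration by parts over a period. -/
lemma setIntegral_cube3_mul_fderiv {a b : E3 → ℝ} (ha : ContDiff ℝ 1 a) (hb : ContDiff ℝ 1 b)
    (hpa : ∀ (x : E3) (i : Fin 3), a (x + (2 * π) • e3 i) = a x)
    (hpb : ∀ (x : E3) (i : Fin 3), b (x + (2 * π) • e3 i) = b x) (j : Fin 3) :
    ∫ x in cube3, a x * fderiv ℝ b x (e3 j) = - ∫ x in cube3, fderiv ℝ a x (e3 j) * b x := by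
  have h := setIntegral_cube3_fderiv_eq_zero (ha.mul hb) (fun x i => by rw [hpa, hpb]) j
  have hab : ∀ x, fderiv ℝ (fun y => a y * b y) x (e3 j)
      = a x * fderiv ℝ b x (e3 j) + fderiv ℝ a x (e3 j) * b x := by
    intro x
    rw [fderiv_fun_mul (ha.differentiable (by norm_num) x) (hb.differentiable (by norm_num) x)]
    simp; ring
  simp only [hab] at h
  have hca := (ha.continuous_fderiv (by norm_num)).clm_apply (continuous_const (y := e3 j))
  have hcb := (hb.continuous_fderiv (by norm_num)).clm_apply (continuous_const (y := e3 j))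
  rw [integral_add
    (Continuous.integrableOn_cube3 (g := fun x => a x * fderiv ℝ b x (e3 j))
      (ha.continuous.mul hcb))
    (Continuous.integrableOn_cube3 (g := fun x => fderiv ℝ a x (e3 j) * b x)
      (hca.mul hb.continuous))] at h
  linarith

/-- The part `𝕋³ × {|v| ≤ R}` of phase space. -/
def phaseSet (R : ℝ) : Set (E3 × E3) := cube3 ×ˢ Metric.closedBall (0 : E3) R

lemma isCompact_phaseSet (R : ℝ) : IsCompact (phaseSet R) :=
  isCompact_cube3.prod (isCompact_closedBall _ _)

lemma Continuous.integrableOn_phaseSet {G : E3 × E3 → ℝ} (hG : Continuous G) (R : ℝ) :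
    IntegrableOn G (phaseSet R) :=
  hG.continuousOn.integrableOn_compact (isCompact_phaseSet R)

lemma setIntegral_phaseSet {G : E3 × E3 → ℝ} (hG : Continuous G) (R : ℝ) :
    ∫ z in phaseSet R, G z = ∫ x in cube3, ∫ v in Metric.closedBall (0 : E3) R, G (x, v) :=
  setIntegral_prod G (Continuous.integrableOn_phaseSet hG R)

lemma setIntegral_phaseSet_swap {G : E3 × E3 → ℝ} (hG : Continuous G) (R : ℝ) :
    ∫ z in phaseSet R, G z = ∫ v in Metric.closedBall (0 : E3) R, ∫ x in cube3, G (x, v) := by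
  have hs : Continuous fun z : E3 × E3 => G z.swap := hG.comp continuous_swap
  have h := setIntegral_prod (μ := volume) (ν := volume) (fun z : E3 × E3 => G z.swap)
    (hs.continuousOn.integrableOn_compact
      ((isCompact_closedBall (0 : E3) R).prod isCompact_cube3))
  exact (setIntegral_prod_swap (μ := volume) (ν := volume) _ _ G).symm.trans h

/-- For integrands supported in `{|v| ≤ R}` the iterated integral over `𝕋³ × ℝ³` is an integral
over a compact set. -/
lemma setIntegral_cube3_integral {G : E3 × E3 → ℝ} (hG : Continuous G) {R : ℝ}
    (hR : ∀ x v, R < ‖v‖ → G (x, v) = 0) :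
    ∫ x in cube3, ∫ v, G (x, v) = ∫ z in phaseSet R, G z := by
  rw [setIntegral_phaseSet hG]
  congr 1
  ext x
  exact (setIntegral_eq_integral_of_forall_compl_eq_zero fun v hv => hR x v (by simpa using hv)).symm

lemma fderiv_fst_eq {g : E3 → E3 → ℝ} (hg : ContDiff ℝ 1 fun z : E3 × E3 => g z.1 z.2)
    (z : E3 × E3) (e : E3) :
    fderiv ℝ (fun y => g y z.2) z.1 e = fderiv ℝ (fun z : E3 × E3 => g z.1 z.2) z (e, 0) := by
  have h1 := (hg.differentiable (by norm_num) z).hasFDerivAt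
  have h2 : HasFDerivAt (fun y : E3 => (y, z.2)) (ContinuousLinearMap.inl ℝ E3 E3) z.1 :=
    hasFDerivAt_prodMk_left z.1 z.2
  have h3 := HasFDerivAt.comp z.1 h1 h2
  have h4 : fderiv ℝ (fun y => g y z.2) z.1 = _ := h3.fderiv
  rw [h4]; rfl

lemma fderiv_snd_eq {g : E3 → E3 → ℝ} (hg : ContDiff ℝ 1 fun z : E3 × E3 => g z.1 z.2)
    (z : E3 × E3) (e : E3) :
    fderiv ℝ (fun w => g z.1 w) z.2 e = fderiv ℝ (fun z : E3 × E3 => g z.1 z.2) z (0, e) := by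
  have h1 := (hg.differentiable (by norm_num) z).hasFDerivAt
  have h2 : HasFDerivAt (fun y : E3 => (z.1, y)) (ContinuousLinearMap.inr ℝ E3 E3) z.2 :=
    hasFDerivAt_prodMk_right z.1 z.2
  have h3 := HasFDerivAt.comp z.2 h1 h2
  have h4 : fderiv ℝ (fun y => g z.1 y) z.2 = _ := h3.fderiv
  rw [h4]; rfl

lemma continuous_fderiv_fst {g : E3 → E3 → ℝ} (hg : ContDiff ℝ 1 fun z : E3 × E3 => g z.1 z.2)
    (e : E3) : Continuous fun z : E3 × E3 => fderiv ℝ (fun y => g y z.2) z.1 e := by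
  simp only [fderiv_fst_eq hg]
  exact (hg.continuous_fderiv (by norm_num)).clm_apply continuous_const

lemma continuous_fderiv_snd {g : E3 → E3 → ℝ} (hg : ContDiff ℝ 1 fun z : E3 × E3 => g z.1 z.2)
    (e : E3) : Continuous fun z : E3 × E3 => fderiv ℝ (fun w => g z.1 w) z.2 e := by
  simp only [fderiv_snd_eq hg]
  exact (hg.continuous_fderiv (by norm_num)).clm_apply continuous_const

/-- Free transport does not change velocity moments. -/
lemma setIntegral_phaseSet_transport {g : E3 → E3 → ℝ}
    (hg : ContDiff ℝ 1 fun z : E3 × E3 => g z.1 z.2)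
    (hper : ∀ (x v : E3) (i : Fin 3), g (x + (2 * π) • e3 i) v = g x v)
    {φ : E3 → ℝ} (hφ : Continuous φ) (R : ℝ) (i : Fin 3) :
    ∫ z in phaseSet R, φ z.2 * fderiv ℝ (fun y => g y z.2) z.1 (e3 i) = 0 := by
  rw [setIntegral_phaseSet_swap
    (G := fun z : E3 × E3 => φ z.2 * fderiv ℝ (fun y => g y z.2) z.1 (e3 i))
    ((hφ.comp continuous_snd).mul (continuous_fderiv_fst hg (e3 i)))]
  have h0 : ∀ v : E3, ∫ x in cube3, φ v * fderiv ℝ (fun y => g y v) x (e3 i) = 0 := by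
    intro v
    have hgv : ContDiff ℝ 1 fun y => g y v := hg.comp (contDiff_id.prodMk contDiff_const)
    rw [integral_const_mul, setIntegral_cube3_fderiv_eq_zero hgv (fun x i => hper x v i), mul_zero]
  simp [h0]

/-- Integration by parts in the velocity variable. -/
lemma setIntegral_phaseSet_mul_fderiv_snd {g : E3 → E3 → ℝ}
    (hg : ContDiff ℝ 1 fun z : E3 × E3 => g z.1 z.2) {R : ℝ}
    (hR : ∀ x v, R ≤ ‖v‖ → g x v = 0) {φ : E3 → ℝ} (hφ : ContDiff ℝ 1 φ) (i : Fin 3) :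
    ∫ z in phaseSet R, φ z.2 * fderiv ℝ (fun w => g z.1 w) z.2 (e3 i)
      = - ∫ z in phaseSet R, fderiv ℝ φ z.2 (e3 i) * g z.1 z.2 := by
  have hφ' : Continuous fun v => fderiv ℝ φ v (e3 i) :=
    (hφ.continuous_fderiv (by norm_num)).clm_apply continuous_const
  have hdg : ∀ x v, R < ‖v‖ → fderiv ℝ (fun w => g x w) v (e3 i) = 0 := by
    intro x v hv
    have : (fun w => g x w) =ᶠ[nhds v] fun _ => 0 := by
      filter_upwards [(isOpen_lt continuous_const continuous_norm).mem_nhds hv] with w hw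
      exact hR x w (le_of_lt hw)
    rw [this.fderiv_eq]; simp
  have hc1 : Continuous fun z : E3 × E3 => φ z.2 * fderiv ℝ (fun w => g z.1 w) z.2 (e3 i) :=
    (hφ.continuous.comp continuous_snd).mul (continuous_fderiv_snd hg (e3 i))
  have hc2 : Continuous fun z : E3 × E3 => fderiv ℝ φ z.2 (e3 i) * g z.1 z.2 :=
    (hφ'.comp continuous_snd).mul hg.continuous
  rw [← setIntegral_cube3_integral hc1 (fun x v hv => by simp [hdg x v hv]),
    ← setIntegral_cube3_integral hc2 (fun x v hv => by simp [hR x v hv.le]), ← integral_neg]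
  congr 1
  ext x
  have hgx : ContDiff ℝ 1 fun w => g x w := hg.comp (contDiff_const.prodMk contDiff_id)
  have hsupp : ∀ G : E3 → ℝ, Continuous G → (∀ v, R < ‖v‖ → G v = 0) → Integrable G := by
    intro G hG h0
    refine hG.integrable_of_hasCompactSupport
      (HasCompactSupport.intro (isCompact_closedBall (0 : E3) R) fun v hv => h0 v ?_)
    simpa using hv
  refine integral_mul_fderiv_eq_neg_fderiv_mul_of_integrable (hsupp _ ?_ ?_) (hsupp _ ?_ ?_)
    (hsupp _ ?_ ?_) (fun v _ => hφ.differentiable (by norm_num) v)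
    (fun v _ => hgx.differentiable (by norm_num) v)
  · exact hφ'.mul hgx.continuous
  · exact fun v hv => by simp [hR x v hv.le]
  · exact hφ.continuous.mul ((hgx.continuous_fderiv (by norm_num)).clm_apply continuous_const)
  · exact fun v hv => by simp [hdg x v hv]
  · exact hφ.continuous.mul hgx.continuous
  · exact fun v hv => by simp [hR x v hv.le]

lemma integral_fin_three_sum {X : Type*} [MeasurableSpace X] {μ : Measure X}
    {F : Fin 3 → X → ℝ} (h : ∀ i, Integrable (F i) μ) :
    ∫ x, ∑ i, F i x ∂μ = ∑ i, ∫ x, F i x ∂μ :=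
  integral_finsetSum _ fun i _ => h i

namespace IsClassicalVNS

variable {ε γ σ T : ℝ} {u : ℝ → E3 → E3} {p : ℝ → E3 → ℝ} {f : ℝ → E3 → E3 → ℝ}

lemma contDiff_f (h : IsClassicalVNS ε γ σ T u p f) {t : ℝ} (ht : t ∈ Set.Icc (0:ℝ) T) :
    ContDiff ℝ 1 fun z : E3 × E3 => f t z.1 z.2 := by
  rw [← contDiffOn_univ]
  exact h.f_reg.comp (t := Set.Icc 0 T ×ˢ (Set.univ : Set (E3 × E3)))
    (f := fun z : E3 × E3 => (t, z)) (contDiff_const.prodMk contDiff_id).contDiffOn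
    (fun z _ => ⟨ht, trivial⟩)

lemma contDiff_u (h : IsClassicalVNS ε γ σ T u p f) {t : ℝ} (ht : t ∈ Set.Icc (0:ℝ) T)
    (i : Fin 3) : ContDiff ℝ 2 fun x => u t x i :=
  (EuclideanSpace.proj (𝕜 := ℝ) i).contDiff.comp (h.u_reg_x t ht)

lemma continuous_u (h : IsClassicalVNS ε γ σ T u p f) {t : ℝ} (ht : t ∈ Set.Icc (0:ℝ) T)
    (i : Fin 3) : Continuous fun x => u t x i := (h.contDiff_u ht i).continuous

lemma contDiffOn_u (h : IsClassicalVNS ε γ σ T u p f) (i : Fin 3) :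
    ContDiffOn ℝ 1 (fun q : ℝ × E3 => u q.1 q.2 i) (Set.Icc 0 T ×ˢ Set.univ) :=
  (EuclideanSpace.proj (𝕜 := ℝ) i).contDiff.comp_contDiffOn h.u_reg_t

/-- Evolution of the velocity moments of `f`. -/
lemma hasDerivWithinAt_moment (h : IsClassicalVNS ε γ σ T u p f) (hT : 0 < T) {R : ℝ}
    (hR : ∀ t ∈ Set.Icc (0:ℝ) T, ∀ (x v : E3), R ≤ ‖v‖ → f t x v = 0)
    {φ : E3 → ℝ} (hφ : ContDiff ℝ 1 φ) {t : ℝ} (ht : t ∈ Set.Icc (0:ℝ) T) :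
    HasDerivWithinAt (fun s => ∫ z in phaseSet R, φ z.2 * f s z.1 z.2)
      (ε⁻¹ * ∫ z in phaseSet R, ∑ i, fderiv ℝ φ z.2 (e3 i) *
        (f t z.1 z.2 * (σ * u t z.1 i - z.2 i))) (Set.Icc 0 T) t := by
  have hF : ContDiffOn ℝ 1 (fun q : ℝ × E3 × E3 => φ q.2.2 * f q.1 q.2.1 q.2.2)
      (Set.Icc 0 T ×ˢ Set.univ) :=
    (hφ.comp (contDiff_snd.comp contDiff_snd)).contDiffOn.mul h.f_reg
  have hd := hasDerivWithinAt_setIntegral_of_contDiffOn (μ := volume) (isCompact_phaseSet R) hT hF ht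
  convert hd using 1
  have hf := h.contDiff_f ht
  have hg : ∀ i : Fin 3, ContDiff ℝ 1
      fun z : E3 × E3 => f t z.1 z.2 * (σ * u t z.1 i - z.2 i) := by
    intro i
    refine hf.mul ((contDiff_const.mul ((h.contDiff_u ht i).of_le (by norm_num) |>.comp
      contDiff_fst)).sub ?_)
    exact (EuclideanSpace.proj (𝕜 := ℝ) i).contDiff.comp contDiff_snd
  have hv : ∀ i : Fin 3, Continuous fun z : E3 × E3 => z.2 i := fun i => by fun_prop
  have hcφ : Continuous fun z : E3 × E3 => φ z.2 := hφ.continuous.comp continuous_snd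
  have hcd : ∀ i, Continuous fun z : E3 × E3 => fderiv ℝ φ z.2 (e3 i) := fun i =>
    ((hφ.continuous_fderiv (by norm_num)).clm_apply continuous_const).comp continuous_snd
  have hpt : ∀ z : E3 × E3,
      derivWithin (fun s => φ z.2 * f s z.1 z.2) (Set.Icc 0 T) t
      = ∑ i, (-σ⁻¹) * ((φ z.2 * z.2 i) * fderiv ℝ (fun y => f t y z.2) z.1 (e3 i))
        + ∑ i, (-ε⁻¹) * (φ z.2 *
          fderiv ℝ (fun w => f t z.1 w * (σ * u t z.1 i - w i)) z.2 (e3 i)) := by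
    intro z
    rw [derivWithin_const_mul_field]
    have := h.vlasov t ht z.1 z.2
    rw [← eq_sub_iff_add_eq, zero_sub, ← eq_sub_iff_add_eq] at this
    rw [this, mul_sub, Finset.mul_sum, Finset.mul_sum, mul_neg, Finset.mul_sum, Finset.mul_sum,
      ← Finset.sum_neg_distrib, sub_eq_add_neg, ← Finset.sum_neg_distrib, add_comm]
    congr 1 <;> exact Finset.sum_congr rfl fun i _ => by ring
  have hc1 : ∀ i : Fin 3, Continuous fun z : E3 × E3 => (-σ⁻¹) * ((φ z.2 * z.2 i) *
      fderiv ℝ (fun y => f t y z.2) z.1 (e3 i)) := fun i =>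
    continuous_const.mul ((hcφ.mul (hv i)).mul (continuous_fderiv_fst hf (e3 i)))
  have hc2 : ∀ i : Fin 3, Continuous fun z : E3 × E3 => (-ε⁻¹) * (φ z.2 *
      fderiv ℝ (fun w => f t z.1 w * (σ * u t z.1 i - w i)) z.2 (e3 i)) := fun i =>
    continuous_const.mul (hcφ.mul
      (continuous_fderiv_snd (g := fun x w => f t x w * (σ * u t x i - w i)) (hg i) (e3 i)))
  have hc3 : ∀ i : Fin 3, Continuous fun z : E3 × E3 => fderiv ℝ φ z.2 (e3 i) *
      (f t z.1 z.2 * (σ * u t z.1 i - z.2 i)) := fun i => (hcd i).mul (hg i).continuous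
  simp only [hpt]
  rw [integral_add
      (Continuous.integrableOn_phaseSet (continuous_finsetSum _ fun i _ => hc1 i) R)
      (Continuous.integrableOn_phaseSet (continuous_finsetSum _ fun i _ => hc2 i) R),
    integral_fin_three_sum (fun i => Continuous.integrableOn_phaseSet (hc1 i) R),
    integral_fin_three_sum (fun i => Continuous.integrableOn_phaseSet (hc2 i) R),
    integral_fin_three_sum (fun i => Continuous.integrableOn_phaseSet (hc3 i) R),
    Finset.mul_sum]
  have htr : ∀ i : Fin 3, ∫ z in phaseSet R, (-σ⁻¹) * ((φ z.2 * z.2 i) *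
      fderiv ℝ (fun y => f t y z.2) z.1 (e3 i)) = 0 := by
    intro i
    rw [integral_const_mul, setIntegral_phaseSet_transport (φ := fun v => φ v * v i) hf
      (h.f_periodic t ht) (by fun_prop) R i, mul_zero]
  simp only [htr, Finset.sum_const_zero, zero_add]
  refine Finset.sum_congr rfl fun i _ => ?_
  rw [integral_const_mul, setIntegral_phaseSet_mul_fderiv_snd
    (g := fun x w => f t x w * (σ * u t x i - w i)) (hg i)
    (fun x v hv => by simp [hR t ht x v hv]) hφ i]
  ring

/-- The drag force as a velocity integral. -/
lemma kmom_sub_kdens_mul (h : IsClassicalVNS ε γ σ T u p f) {R : ℝ}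
    (hR : ∀ t ∈ Set.Icc (0:ℝ) T, ∀ (x v : E3), R ≤ ‖v‖ → f t x v = 0)
    {t : ℝ} (ht : t ∈ Set.Icc (0:ℝ) T) (x : E3) (i : Fin 3) (c : ℝ) :
    kmom σ f t x i - kdens f t x * c = ∫ v : E3, (σ⁻¹ * v i - c) * f t x v := by
  have hfx : Continuous fun v => f t x v :=
    (h.contDiff_f ht).continuous.comp (Continuous.prodMk_right x)
  have hsupp : ∀ a : E3 → ℝ, Continuous a → Integrable fun v => a v * f t x v := by
    intro a ha
    refine (ha.mul hfx).integrable_of_hasCompactSupport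
      (HasCompactSupport.intro (isCompact_closedBall (0 : E3) R) fun v hv => ?_)
    have hv' : R < ‖v‖ := by simpa using hv
    simp [hR t ht x v hv'.le]
  have h1 : ∀ j : Fin 3, Integrable fun v : E3 => (f t x v • v) j := fun j => by
    simpa [mul_comm] using hsupp (fun v => v j) (by fun_prop)
  have h2 : kmom σ f t x i = ∫ v : E3, (σ⁻¹ * v i) * f t x v := by
    rw [kmom, PiLp.smul_apply, eval_integral_piLp h1, smul_eq_mul, ← integral_const_mul]
    congr 1
    ext v
    simp; ring
  rw [h2, kdens, ← integral_mul_const, ← integral_sub (hsupp (fun v => σ⁻¹ * v i) (by fun_prop))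
    ((by simpa using hsupp (fun _ => 1) continuous_const : Integrable fun v => f t x v).mul_const c)]
  congr 1
  ext v
  ring

lemma continuous_phase_f (h : IsClassicalVNS ε γ σ T u p f) {t : ℝ}
    (ht : t ∈ Set.Icc (0:ℝ) T) {a : E3 × E3 → ℝ} (ha : Continuous a) :
    Continuous fun z : E3 × E3 => a z * f t z.1 z.2 :=
  ha.mul (h.contDiff_f ht).continuous

lemma continuous_slip (h : IsClassicalVNS ε γ σ T u p f) {t : ℝ} (ht : t ∈ Set.Icc (0:ℝ) T)
    (i : Fin 3) : Continuous fun z : E3 × E3 => σ⁻¹ * z.2 i - u t z.1 i :=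
  (continuous_const.mul (by fun_prop)).sub ((h.continuous_u ht i).comp continuous_fst)

lemma fderiv_periodic {g : E3 → ℝ} (hper : ∀ (x : E3) (i : Fin 3), g (x + (2 * π) • e3 i) = g x)
    (e x : E3) (i : Fin 3) : fderiv ℝ g (x + (2 * π) • e3 i) e = fderiv ℝ g x e := by
  rw [← fderiv_comp_add_right]
  simp only [hper]

lemma u_periodic_apply (h : IsClassicalVNS ε γ σ T u p f) {t : ℝ} (ht : t ∈ Set.Icc (0:ℝ) T)
    (j : Fin 3) (x : E3) (i : Fin 3) : u t (x + (2 * π) • e3 i) j = u t x j := by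
  rw [h.u_periodic t ht]

lemma contDiff_fderiv_u (h : IsClassicalVNS ε γ σ T u p f) {t : ℝ} (ht : t ∈ Set.Icc (0:ℝ) T)
    (i j : Fin 3) : ContDiff ℝ 1 fun x => fderiv ℝ (fun y => u t y i) x (e3 j) :=
  ((h.contDiff_u ht i).fderiv_right (m := 1) (by norm_num)).clm_apply contDiff_const

lemma setIntegral_convective (h : IsClassicalVNS ε γ σ T u p f) {t : ℝ}
    (ht : t ∈ Set.Icc (0:ℝ) T) {w : E3 → ℝ} (hw : ContDiff ℝ 1 w)
    (hpw : ∀ (x : E3) (i : Fin 3), w (x + (2 * π) • e3 i) = w x) (i : Fin 3) :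
    ∫ x in cube3, ∑ j, (w x * u t x j) * fderiv ℝ (fun y => u t y i) x (e3 j)
      = - ∫ x in cube3, ∑ j, (u t x i * u t x j) * fderiv ℝ w x (e3 j) := by
  have hu1 : ∀ i, ContDiff ℝ 1 fun x => u t x i := fun i =>
    (h.contDiff_u ht i).of_le (by norm_num)
  have hdw : ∀ j, Continuous fun x => fderiv ℝ w x (e3 j) := fun j =>
    (hw.continuous_fderiv (by norm_num)).clm_apply continuous_const
  have hdu : ∀ i j, Continuous fun x => fderiv ℝ (fun y => u t y i) x (e3 j) := fun i j =>
    (h.contDiff_fderiv_u ht i j).continuous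
  have hprod : ∀ x j, fderiv ℝ (fun y => w y * u t y j) x (e3 j)
      = fderiv ℝ w x (e3 j) * u t x j + w x * fderiv ℝ (fun y => u t y j) x (e3 j) := by
    intro x j
    rw [fderiv_fun_mul (hw.differentiable (by norm_num) x)
      ((hu1 j).differentiable (by norm_num) x)]
    simp; ring
  have hc1 : ∀ j, Continuous fun x => (w x * u t x j) * fderiv ℝ (fun y => u t y i) x (e3 j) :=
    fun j => (hw.continuous.mul (h.continuous_u ht j)).mul (hdu i j)
  have hc2 : ∀ j, Continuous fun x => fderiv ℝ (fun y => w y * u t y j) x (e3 j) * u t x i := by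
    intro j
    simp only [hprod]
    exact (((hdw j).mul (h.continuous_u ht j)).add (hw.continuous.mul (hdu j j))).mul
      (h.continuous_u ht i)
  rw [integral_fin_three_sum fun j => Continuous.integrableOn_cube3 (hc1 j)]
  have hibp : ∀ j, ∫ x in cube3, (w x * u t x j) * fderiv ℝ (fun y => u t y i) x (e3 j)
      = - ∫ x in cube3, fderiv ℝ (fun y => w y * u t y j) x (e3 j) * u t x i := fun j =>
    setIntegral_cube3_mul_fderiv (a := fun x => w x * u t x j) (hw.mul (hu1 j)) (hu1 i)
      (fun x k => by rw [hpw, h.u_periodic t ht]) (h.u_periodic_apply ht i) j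
  simp only [hibp]
  rw [Finset.sum_neg_distrib, ← integral_fin_three_sum fun j => Continuous.integrableOn_cube3 (hc2 j)]
  congr 2
  ext x
  have hdiv := h.u_div_free t ht x
  simp only [hprod, Fin.sum_univ_three] at hdiv ⊢
  linear_combination (w x * u t x i) * hdiv

/-- The momentum equation tested against a periodic function. -/
lemma fluid_weak (h : IsClassicalVNS ε γ σ T u p f) (hT : 0 < T) {R : ℝ}
    (hR : ∀ t ∈ Set.Icc (0:ℝ) T, ∀ (x v : E3), R ≤ ‖v‖ → f t x v = 0) {t : ℝ}
    (ht : t ∈ Set.Icc (0:ℝ) T) {w : E3 → ℝ} (hw : ContDiff ℝ 1 w)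
    (hpw : ∀ (x : E3) (i : Fin 3), w (x + (2 * π) • e3 i) = w x) (i : Fin 3) :
    ∫ x in cube3, w x * derivWithin (fun s => u s x i) (Set.Icc 0 T) t
      = γ⁻¹ * (∫ z in phaseSet R, w z.1 * (σ⁻¹ * z.2 i - u t z.1 i) * f t z.1 z.2)
        - (∫ x in cube3, ∑ j, (w x * u t x j) * fderiv ℝ (fun y => u t y i) x (e3 j))
        - (∫ x in cube3, ∑ j, fderiv ℝ w x (e3 j) * fderiv ℝ (fun y => u t y i) x (e3 j))
        + ∫ x in cube3, fderiv ℝ w x (e3 i) * p t x := by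
  have hdw : ∀ j, Continuous fun x => fderiv ℝ w x (e3 j) := fun j =>
    (hw.continuous_fderiv (by norm_num)).clm_apply continuous_const
  have hdu : ∀ i j, Continuous fun x => fderiv ℝ (fun y => u t y i) x (e3 j) := fun i j =>
    (h.contDiff_fderiv_u ht i j).continuous
  have hct : Continuous fun x => derivWithin (fun s => u s x i) (Set.Icc 0 T) t := by
    have h1 := (exists_continuousOn_timeDeriv hT (h.contDiffOn_u i)).1
    rw [← continuousOn_univ]
    exact h1.comp (f := fun x : E3 => (t, x)) (by fun_prop) (fun x _ => ⟨ht, trivial⟩)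
  have hcp : Continuous fun x => fderiv ℝ (p t) x (e3 i) :=
    ((h.p_reg_x t ht).continuous_fderiv (by norm_num)).clm_apply continuous_const
  have hcdd : ∀ j, Continuous fun x =>
      fderiv ℝ (fun y => fderiv ℝ (fun z => u t z i) y (e3 j)) x (e3 j) := fun j =>
    ((h.contDiff_fderiv_u ht i j).continuous_fderiv (by norm_num)).clm_apply continuous_const
  have hdrag : ∫ x in cube3, w x * (γ⁻¹ * (kmom σ f t x i - kdens f t x * u t x i))
      = γ⁻¹ * (∫ z in phaseSet R, w z.1 * (σ⁻¹ * z.2 i - u t z.1 i) * f t z.1 z.2) := by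
    have hc : Continuous fun z : E3 × E3 => w z.1 * (σ⁻¹ * z.2 i - u t z.1 i) :=
      (hw.continuous.comp continuous_fst).mul (h.continuous_slip ht i)
    rw [← setIntegral_cube3_integral (h.continuous_phase_f ht hc) (R := R)
      (fun x v hv => by rw [hR t ht x v hv.le, mul_zero]), ← integral_const_mul]
    congr 1
    ext x
    rw [h.kmom_sub_kdens_mul hR ht]
    simp only [mul_assoc, integral_const_mul]
    ring
  have hpt : ∀ x, w x * (γ⁻¹ * (kmom σ f t x i - kdens f t x * u t x i))
      = w x * derivWithin (fun s => u s x i) (Set.Icc 0 T) t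
        + (∑ j, (w x * u t x j) * fderiv ℝ (fun y => u t y i) x (e3 j)
        + (w x * fderiv ℝ (p t) x (e3 i) - ∑ j, w x *
          fderiv ℝ (fun y => fderiv ℝ (fun z => u t z i) y (e3 j)) x (e3 j))) := by
    intro x
    rw [← h.navier_stokes t ht x i]
    simp only [Fin.sum_univ_three]
    ring
  have hc2 : Continuous fun x => ∑ j, (w x * u t x j) * fderiv ℝ (fun y => u t y i) x (e3 j) :=
    continuous_finsetSum _ fun j _ => (hw.continuous.mul (h.continuous_u ht j)).mul (hdu i j)
  have hc3 : ∀ j, Continuous fun x => w x *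
      fderiv ℝ (fun y => fderiv ℝ (fun z => u t z i) y (e3 j)) x (e3 j) := fun j =>
    hw.continuous.mul (hcdd j)
  have hc3' := continuous_finsetSum Finset.univ fun j _ => hc3 j
  have hc4 : Continuous fun x => w x * fderiv ℝ (p t) x (e3 i) := hw.continuous.mul hcp
  have hc1 : Continuous fun x => w x * derivWithin (fun s => u s x i) (Set.Icc 0 T) t :=
    hw.continuous.mul hct
  rw [← hdrag]
  simp only [hpt]
  have hc5 : Continuous fun x => w x * fderiv ℝ (p t) x (e3 i) - ∑ j, w x *
      fderiv ℝ (fun y => fderiv ℝ (fun z => u t z i) y (e3 j)) x (e3 j) := hc4.sub hc3'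
  have hc6 : Continuous fun x => ∑ j, (w x * u t x j) * fderiv ℝ (fun y => u t y i) x (e3 j)
      + (w x * fderiv ℝ (p t) x (e3 i) - ∑ j, w x *
        fderiv ℝ (fun y => fderiv ℝ (fun z => u t z i) y (e3 j)) x (e3 j)) := hc2.add hc5
  rw [integral_add (Continuous.integrableOn_cube3 hc1) (Continuous.integrableOn_cube3 hc6),
    integral_add (Continuous.integrableOn_cube3 hc2) (Continuous.integrableOn_cube3 hc5),
    integral_sub (Continuous.integrableOn_cube3 hc4) (Continuous.integrableOn_cube3 hc3'),
    integral_fin_three_sum fun j => Continuous.integrableOn_cube3 (hc3 j),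
    integral_fin_three_sum fun j => Continuous.integrableOn_cube3
      (g := fun x => fderiv ℝ w x (e3 j) * fderiv ℝ (fun y => u t y i) x (e3 j))
      ((hdw j).mul (hdu i j)),
    setIntegral_cube3_mul_fderiv hw (h.p_reg_x t ht) hpw (h.p_periodic t ht) i]
  have hibp : ∀ j, ∫ x in cube3, w x *
      fderiv ℝ (fun y => fderiv ℝ (fun z => u t z i) y (e3 j)) x (e3 j)
      = - ∫ x in cube3, fderiv ℝ w x (e3 j) * fderiv ℝ (fun y => u t y i) x (e3 j) := fun j =>
    setIntegral_cube3_mul_fderiv hw (h.contDiff_fderiv_u ht i j) hpw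
      (fderiv_periodic (h.u_periodic_apply ht i) (e3 j)) j
  simp only [hibp, Finset.sum_neg_distrib]
  ring

/-- Evolution of the mean fluid velocity. -/
lemma hasDerivWithinAt_mean_u (h : IsClassicalVNS ε γ σ T u p f) (hT : 0 < T) {R : ℝ}
    (hR : ∀ t ∈ Set.Icc (0:ℝ) T, ∀ (x v : E3), R ≤ ‖v‖ → f t x v = 0) {t : ℝ}
    (ht : t ∈ Set.Icc (0:ℝ) T) (i : Fin 3) :
    HasDerivWithinAt (fun s => ∫ x in cube3, u s x i)
      (γ⁻¹ * ∫ z in phaseSet R, (σ⁻¹ * z.2 i - u t z.1 i) * f t z.1 z.2) (Set.Icc 0 T) t := by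
  have hd := hasDerivWithinAt_setIntegral_of_contDiffOn (μ := volume) isCompact_cube3 hT
    (h.contDiffOn_u i) ht
  convert hd using 1
  have hweak := h.fluid_weak hT hR ht (w := fun _ => 1) contDiff_const (fun _ _ => rfl) i
  rw [h.setIntegral_convective ht (w := fun _ => 1) contDiff_const (fun _ _ => rfl) i] at hweak
  simpa using hweak.symm

/-- Evolution of the kinetic energy of the fluid. -/
lemma hasDerivWithinAt_energy_u (h : IsClassicalVNS ε γ σ T u p f) (hT : 0 < T) {R : ℝ}
    (hR : ∀ t ∈ Set.Icc (0:ℝ) T, ∀ (x v : E3), R ≤ ‖v‖ → f t x v = 0) {t : ℝ}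
    (ht : t ∈ Set.Icc (0:ℝ) T) :
    HasDerivWithinAt (fun s => ∫ x in cube3, ∑ i, u s x i ^ 2)
      (2 * (γ⁻¹ * (∫ z in phaseSet R,
          (∑ i, u t z.1 i * (σ⁻¹ * z.2 i - u t z.1 i)) * f t z.1 z.2)
        - ∫ x in cube3, ∑ i, ∑ j, fderiv ℝ (fun y => u t y i) x (e3 j) ^ 2))
      (Set.Icc 0 T) t := by
  have hF : ContDiffOn ℝ 1 (fun q : ℝ × E3 => ∑ i, u q.1 q.2 i ^ 2)
      (Set.Icc 0 T ×ˢ Set.univ) := ContDiffOn.sum fun i _ => (h.contDiffOn_u i).pow 2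
  have hd := hasDerivWithinAt_setIntegral_of_contDiffOn (μ := volume) isCompact_cube3 hT hF ht
  convert hd using 1
  have hu := h.continuous_u ht
  have hu1 : ∀ i, ContDiff ℝ 1 fun x => u t x i := fun i =>
    (h.contDiff_u ht i).of_le (by norm_num)
  have hdu : ∀ i j, Continuous fun x => fderiv ℝ (fun y => u t y i) x (e3 j) := fun i j =>
    (h.contDiff_fderiv_u ht i j).continuous
  have hct : ∀ i, Continuous fun x => derivWithin (fun s => u s x i) (Set.Icc 0 T) t := by
    intro i
    have h1 := (exists_continuousOn_timeDeriv hT (h.contDiffOn_u i)).1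
    rw [← continuousOn_univ]
    exact h1.comp (f := fun x : E3 => (t, x)) (by fun_prop) (fun x _ => ⟨ht, trivial⟩)
  have hpt : ∀ x, derivWithin (fun s => ∑ i, u s x i ^ 2) (Set.Icc 0 T) t
      = ∑ i, 2 * (u t x i * derivWithin (fun s => u s x i) (Set.Icc 0 T) t) := by
    intro x
    have hd1 : ∀ i, HasDerivWithinAt (fun s => u s x i)
        (derivWithin (fun s => u s x i) (Set.Icc 0 T) t) (Set.Icc 0 T) t := fun i =>
      (exists_continuousOn_timeDeriv hT (h.contDiffOn_u i)).2 t ht x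
    have hd2 := HasDerivWithinAt.fun_sum (u := Finset.univ) fun i _ => (hd1 i).fun_pow 2
    rw [hd2.derivWithin (uniqueDiffOn_Icc hT t ht)]
    exact Finset.sum_congr rfl fun i _ => by norm_num; ring
  have hself : ∀ i,
      ∫ x in cube3, ∑ j, (u t x i * u t x j) * fderiv ℝ (fun y => u t y i) x (e3 j) = 0 := by
    intro i
    have := h.setIntegral_convective ht (hu1 i) (h.u_periodic_apply ht i) i
    linarith
  have hpress : ∑ i, ∫ x in cube3, fderiv ℝ (fun y => u t y i) x (e3 i) * p t x = 0 := by
    rw [← integral_fin_three_sum fun i => Continuous.integrableOn_cube3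
      (g := fun x => fderiv ℝ (fun y => u t y i) x (e3 i) * p t x)
      ((hdu i i).mul (h.p_reg_x t ht).continuous)]
    simp only [← Finset.sum_mul, h.u_div_free t ht, zero_mul, integral_zero]
  have hc1 : ∀ i, Continuous fun z : E3 × E3 =>
      u t z.1 i * (σ⁻¹ * z.2 i - u t z.1 i) * f t z.1 z.2 := by
    intro i
    exact h.continuous_phase_f ht (((hu i).comp continuous_fst).mul (h.continuous_slip ht i))
  simp only [hpt, Finset.sum_mul]
  rw [integral_fin_three_sum fun i => Continuous.integrableOn_phaseSet (hc1 i) R,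
    integral_fin_three_sum fun i => Continuous.integrableOn_cube3
      (g := fun x => ∑ j, fderiv ℝ (fun y => u t y i) x (e3 j) ^ 2)
      (continuous_finsetSum _ fun j _ => (hdu i j).pow 2),
    integral_fin_three_sum fun i => Continuous.integrableOn_cube3
      (g := fun x => 2 * (u t x i * derivWithin (fun s => u s x i) (Set.Icc 0 T) t))
      (continuous_const.mul ((hu i).mul (hct i)))]
  simp only [integral_const_mul]
  have hw := fun i => h.fluid_weak hT hR ht (hu1 i) (h.u_periodic_apply ht i) i
  simp only [hself, ← pow_two] at hw
  simp only [hw, Fin.sum_univ_three] at hpress ⊢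
  linear_combination -2 * hpress

lemma hasDerivWithinAt_mass (h : IsClassicalVNS ε γ σ T u p f) (hT : 0 < T) {R : ℝ}
    (hR : ∀ t ∈ Set.Icc (0:ℝ) T, ∀ (x v : E3), R ≤ ‖v‖ → f t x v = 0) {t : ℝ}
    (ht : t ∈ Set.Icc (0:ℝ) T) :
    HasDerivWithinAt (fun s => ∫ z in phaseSet R, f s z.1 z.2) 0 (Set.Icc 0 T) t := by
  simpa using h.hasDerivWithinAt_moment hT hR (φ := fun _ => 1) contDiff_const ht

/-- Evolution of the mean momentum of the particles. -/
lemma hasDerivWithinAt_momentum (h : IsClassicalVNS ε γ σ T u p f) (hT : 0 < T) (hσ : 0 < σ)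
    {R : ℝ} (hR : ∀ t ∈ Set.Icc (0:ℝ) T, ∀ (x v : E3), R ≤ ‖v‖ → f t x v = 0) {t : ℝ}
    (ht : t ∈ Set.Icc (0:ℝ) T) (i : Fin 3) :
    HasDerivWithinAt (fun s => ∫ z in phaseSet R, z.2 i * f s z.1 z.2)
      (-(ε⁻¹ * σ) * ∫ z in phaseSet R, (σ⁻¹ * z.2 i - u t z.1 i) * f t z.1 z.2)
      (Set.Icc 0 T) t := by
  have hφ : ContDiff ℝ 1 fun v : E3 => v i := (EuclideanSpace.proj (𝕜 := ℝ) i).contDiff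
  convert h.hasDerivWithinAt_moment hT hR hφ ht using 1
  have hd : ∀ (v : E3) (j : Fin 3), fderiv ℝ (fun v : E3 => v i) v (e3 j)
      = if i = j then 1 else 0 := by
    intro v j
    have : fderiv ℝ (fun v : E3 => v i) v = EuclideanSpace.proj (𝕜 := ℝ) i :=
      (EuclideanSpace.proj (𝕜 := ℝ) i).hasFDerivAt.fderiv
    rw [this]
    simp [e3]
  simp only [hd, ite_mul, one_mul, zero_mul, Finset.sum_ite_eq, Finset.mem_univ, if_true]
  rw [← integral_const_mul, ← integral_const_mul]
  congr 1
  ext z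
  field_simp
  ring

/-- Evolution of the kinetic energy of the particles. -/
lemma hasDerivWithinAt_energy_f (h : IsClassicalVNS ε γ σ T u p f) (hT : 0 < T) (hσ : 0 < σ)
    {R : ℝ} (hR : ∀ t ∈ Set.Icc (0:ℝ) T, ∀ (x v : E3), R ≤ ‖v‖ → f t x v = 0) {t : ℝ}
    (ht : t ∈ Set.Icc (0:ℝ) T) :
    HasDerivWithinAt (fun s => ∫ z in phaseSet R, ‖z.2‖ ^ 2 * f s z.1 z.2)
      (-(2 * ε⁻¹ * σ ^ 2) *
        ((∫ z in phaseSet R, (∑ i, (σ⁻¹ * z.2 i - u t z.1 i) ^ 2) * f t z.1 z.2)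
        + ∫ z in phaseSet R, (∑ i, u t z.1 i * (σ⁻¹ * z.2 i - u t z.1 i)) * f t z.1 z.2))
      (Set.Icc 0 T) t := by
  convert h.hasDerivWithinAt_moment hT hR (φ := fun v => ‖v‖ ^ 2) (contDiff_norm_sq ℝ) ht using 1
  have hd : ∀ (v : E3) (j : Fin 3), fderiv ℝ (fun v : E3 => ‖v‖ ^ 2) v (e3 j) = 2 * v j := by
    intro v j
    rw [fderiv_norm_sq_apply]
    simp [e3, EuclideanSpace.inner_single_right]
  have hc1 : Continuous fun z : E3 × E3 =>
      (∑ i, (σ⁻¹ * z.2 i - u t z.1 i) ^ 2) * f t z.1 z.2 :=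
    h.continuous_phase_f ht (continuous_finsetSum _ fun i _ => (h.continuous_slip ht i).pow 2)
  have hc2 : Continuous fun z : E3 × E3 =>
      (∑ i, u t z.1 i * (σ⁻¹ * z.2 i - u t z.1 i)) * f t z.1 z.2 :=
    h.continuous_phase_f ht (continuous_finsetSum _ fun i _ =>
      ((h.continuous_u ht i).comp continuous_fst).mul (h.continuous_slip ht i))
  rw [← integral_add (Continuous.integrableOn_phaseSet hc1 R)
    (Continuous.integrableOn_phaseSet hc2 R), ← integral_const_mul, ← integral_const_mul]
  congr 1
  ext z
  simp only [hd, Fin.sum_univ_three]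
  field_simp
  ring

lemma totalMass_eq (h : IsClassicalVNS ε γ σ T u p f) {R : ℝ}
    (hR : ∀ t ∈ Set.Icc (0:ℝ) T, ∀ (x v : E3), R ≤ ‖v‖ → f t x v = 0) {t : ℝ}
    (ht : t ∈ Set.Icc (0:ℝ) T) :
    totalMass f t = ((2 * π) ^ 3)⁻¹ * ∫ z in phaseSet R, f t z.1 z.2 := by
  rw [totalMass, intT3, ← setIntegral_cube3_integral (h.contDiff_f ht).continuous
    (fun x v hv => hR t ht x v hv.le)]

lemma totalMass_const (h : IsClassicalVNS ε γ σ T u p f) (hT : 0 < T) {t : ℝ}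
    (ht : t ∈ Set.Icc (0:ℝ) T) : totalMass f t = totalMass f 0 := by
  obtain ⟨R, -, hR⟩ := h.f_compact_supp
  have h0 : (0:ℝ) ∈ Set.Icc (0:ℝ) T := ⟨le_rfl, hT.le⟩
  rw [h.totalMass_eq hR ht, h.totalMass_eq hR h0]
  have := (convex_Icc (0:ℝ) T).norm_image_sub_le_of_norm_hasDerivWithin_le (C := 0)
    (fun s hs => h.hasDerivWithinAt_mass hT hR hs) (by simp) h0 ht
  rw [zero_mul, norm_le_zero_iff, sub_eq_zero] at this
  rw [this]

lemma meanVelocity_apply (h : IsClassicalVNS ε γ σ T u p f) {t : ℝ}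
    (ht : t ∈ Set.Icc (0:ℝ) T) (i : Fin 3) :
    meanVelocity u t i = ((2 * π) ^ 3)⁻¹ * ∫ x in cube3, u t x i := by
  rw [meanVelocity, intT3V, PiLp.smul_apply, smul_eq_mul, eval_integral_piLp
    fun j => Continuous.integrableOn_cube3 (h.continuous_u ht j)]

lemma meanMomentum_apply (h : IsClassicalVNS ε γ σ T u p f) {R : ℝ}
    (hR : ∀ t ∈ Set.Icc (0:ℝ) T, ∀ (x v : E3), R ≤ ‖v‖ → f t x v = 0) {t : ℝ}
    (ht : t ∈ Set.Icc (0:ℝ) T) (i : Fin 3) :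
    meanMomentum σ f t i
      = ((2 * π) ^ 3)⁻¹ * (σ⁻¹ * ∫ z in phaseSet R, z.2 i * f t z.1 z.2) := by
  have hkm : ∀ x i, kmom σ f t x i = ∫ v : E3, σ⁻¹ * (v i * f t x v) := by
    intro x i
    have := h.kmom_sub_kdens_mul hR ht x i 0
    simpa [mul_assoc] using this
  have hc : ∀ i : Fin 3, Continuous fun z : E3 × E3 => σ⁻¹ * (z.2 i * f t z.1 z.2) := fun i =>
    continuous_const.mul (h.continuous_phase_f ht (by fun_prop))
  have hball : ∀ i x, ∫ v : E3, σ⁻¹ * (v i * f t x v)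
      = ∫ v in Metric.closedBall (0 : E3) R, σ⁻¹ * (v i * f t x v) := fun i x =>
    (setIntegral_eq_integral_of_forall_compl_eq_zero fun v hv => by
      have hv' : R < ‖v‖ := by simpa using hv
      rw [hR t ht x v hv'.le, mul_zero, mul_zero]).symm
  have hint : ∀ j, IntegrableOn (fun x => kmom σ f t x j) cube3 := by
    intro j
    simp only [hkm, hball]
    have hi : Integrable (fun z : E3 × E3 => σ⁻¹ * (z.2 j * f t z.1 z.2))
        ((volume.restrict cube3).prod (volume.restrict (Metric.closedBall (0 : E3) R))) := by
      rw [Measure.prod_restrict]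
      exact Continuous.integrableOn_phaseSet (hc j) R
    exact hi.integral_prod_left
  rw [meanMomentum, intT3V, PiLp.smul_apply, smul_eq_mul, eval_integral_piLp hint]
  simp only [hkm]
  rw [setIntegral_cube3_integral (R := R) (hc i) (fun x v hv => by
    rw [hR t ht x v hv.le, mul_zero, mul_zero]), integral_const_mul]

lemma intT3_modulated_velocity (h : IsClassicalVNS ε γ σ T u p f) {R : ℝ}
    (hR : ∀ t ∈ Set.Icc (0:ℝ) T, ∀ (x v : E3), R ≤ ‖v‖ → f t x v = 0) {t : ℝ}
    (ht : t ∈ Set.Icc (0:ℝ) T) (a : E3) :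
    intT3 (fun x => ∫ v : E3, ‖σ⁻¹ • v - a‖ ^ 2 * f t x v)
      = ((2 * π) ^ 3)⁻¹ * (σ⁻¹ ^ 2 * (∫ z in phaseSet R, ‖z.2‖ ^ 2 * f t z.1 z.2)
        - 2 * σ⁻¹ * (∑ i, a i * ∫ z in phaseSet R, z.2 i * f t z.1 z.2)
        + (∑ i, a i ^ 2) * ∫ z in phaseSet R, f t z.1 z.2) := by
  have ha : Continuous fun z : E3 × E3 => ‖σ⁻¹ • z.2 - a‖ ^ 2 :=
    ((continuous_snd.const_smul σ⁻¹).sub continuous_const).norm.pow 2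
  have hc : Continuous fun z : E3 × E3 => ‖σ⁻¹ • z.2 - a‖ ^ 2 * f t z.1 z.2 :=
    h.continuous_phase_f ht ha
  rw [intT3, setIntegral_cube3_integral (R := R) hc (fun x v hv => by
    rw [hR t ht x v hv.le, mul_zero])]
  congr 1
  have hc1 : Continuous fun z : E3 × E3 => σ⁻¹ ^ 2 * (‖z.2‖ ^ 2 * f t z.1 z.2) :=
    continuous_const.mul (h.continuous_phase_f ht (continuous_snd.norm.pow 2))
  have hc2 : ∀ i : Fin 3, Continuous fun z : E3 × E3 => a i * (z.2 i * f t z.1 z.2) := fun i =>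
    continuous_const.mul (h.continuous_phase_f ht (by fun_prop))
  have hc2' : Continuous fun z : E3 × E3 => 2 * σ⁻¹ * ∑ i, a i * (z.2 i * f t z.1 z.2) :=
    continuous_const.mul (continuous_finsetSum _ fun i _ => hc2 i)
  have hc12 : Continuous fun z : E3 × E3 => σ⁻¹ ^ 2 * (‖z.2‖ ^ 2 * f t z.1 z.2)
      - 2 * σ⁻¹ * ∑ i, a i * (z.2 i * f t z.1 z.2) := hc1.sub hc2'
  have hc3 : Continuous fun z : E3 × E3 => (∑ i, a i ^ 2) * f t z.1 z.2 :=
    continuous_const.mul (h.contDiff_f ht).continuous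
  have hpt : ∀ z : E3 × E3, ‖σ⁻¹ • z.2 - a‖ ^ 2 * f t z.1 z.2
      = σ⁻¹ ^ 2 * (‖z.2‖ ^ 2 * f t z.1 z.2) - 2 * σ⁻¹ * ∑ i, a i * (z.2 i * f t z.1 z.2)
        + (∑ i, a i ^ 2) * f t z.1 z.2 := by
    intro z
    simp only [EuclideanSpace.real_norm_sq_eq, Fin.sum_univ_three, PiLp.sub_apply,
      PiLp.smul_apply, smul_eq_mul]
    ring
  simp only [hpt]
  rw [integral_add (Continuous.integrableOn_phaseSet hc12 R)
      (Continuous.integrableOn_phaseSet hc3 R),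
    integral_sub (Continuous.integrableOn_phaseSet hc1 R)
      (Continuous.integrableOn_phaseSet hc2' R),
    integral_const_mul, integral_const_mul, integral_const_mul,
    integral_fin_three_sum fun i => Continuous.integrableOn_phaseSet (hc2 i) R]
  simp only [integral_const_mul]

lemma intT3_modulated_u (h : IsClassicalVNS ε γ σ T u p f) {t : ℝ}
    (ht : t ∈ Set.Icc (0:ℝ) T) (b : E3) :
    intT3 (fun x => ‖u t x - b‖ ^ 2)
      = ((2 * π) ^ 3)⁻¹ * ((∫ x in cube3, ∑ i, u t x i ^ 2)
        - 2 * ∑ i, b i * ∫ x in cube3, u t x i) + ∑ i, b i ^ 2 := by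
  have hu := h.continuous_u ht
  have hc1 : Continuous fun x => ∑ i, u t x i ^ 2 :=
    continuous_finsetSum _ fun i _ => (hu i).pow 2
  have hc2 : ∀ i, Continuous fun x => b i * u t x i := fun i => continuous_const.mul (hu i)
  have hc2' : Continuous fun x => 2 * ∑ i, b i * u t x i :=
    continuous_const.mul (continuous_finsetSum _ fun i _ => hc2 i)
  have hc12 : Continuous fun x => (∑ i, u t x i ^ 2) - 2 * ∑ i, b i * u t x i := hc1.sub hc2'
  have hpt : ∀ x, ‖u t x - b‖ ^ 2
      = (∑ i, u t x i ^ 2) - 2 * (∑ i, b i * u t x i) + ∑ i, b i ^ 2 := by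
    intro x
    simp only [EuclideanSpace.real_norm_sq_eq, Fin.sum_univ_three, PiLp.sub_apply]
    ring
  simp only [hpt]
  have hconst := intT3_const (∑ i, b i ^ 2)
  rw [intT3] at hconst
  rw [intT3, integral_add (Continuous.integrableOn_cube3 hc12)
      (Continuous.integrableOn_cube3 continuous_const),
    integral_sub (Continuous.integrableOn_cube3 hc1) (Continuous.integrableOn_cube3 hc2'),
    integral_const_mul, integral_fin_three_sum fun i => Continuous.integrableOn_cube3 (hc2 i)]
  simp only [integral_const_mul]
  rw [mul_add, hconst]

/-- The modulated energy in terms of the moments of `f` and `u`. -/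
lemma modulatedEnergy_eq (h : IsClassicalVNS ε γ σ T u p f) (hT : 0 < T) {R : ℝ}
    (hR : ∀ t ∈ Set.Icc (0:ℝ) T, ∀ (x v : E3), R ≤ ‖v‖ → f t x v = 0)
    (hmass : 0 < totalMass f 0) {t : ℝ} (ht : t ∈ Set.Icc (0:ℝ) T) :
    modulatedEnergy ε γ σ u f t
      = ε / (2 * γ) * (((2 * π) ^ 3)⁻¹ * σ⁻¹ ^ 2 *
          (∫ z in phaseSet R, ‖z.2‖ ^ 2 * f t z.1 z.2)
          - (totalMass f 0)⁻¹ * ∑ i,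
            (((2 * π) ^ 3)⁻¹ * (σ⁻¹ * ∫ z in phaseSet R, z.2 i * f t z.1 z.2)) ^ 2)
        + 1 / 2 * (((2 * π) ^ 3)⁻¹ * (∫ x in cube3, ∑ i, u t x i ^ 2)
          - ∑ i, (((2 * π) ^ 3)⁻¹ * ∫ x in cube3, u t x i) ^ 2)
        + ε * totalMass f 0 / (2 * (γ + ε * totalMass f 0)) *
          ∑ i, ((totalMass f 0)⁻¹ *
            (((2 * π) ^ 3)⁻¹ * (σ⁻¹ * ∫ z in phaseSet R, z.2 i * f t z.1 z.2))
            - ((2 * π) ^ 3)⁻¹ * ∫ x in cube3, u t x i) ^ 2 := by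
  have hm := h.totalMass_eq hR ht
  rw [h.totalMass_const hT ht] at hm
  rw [modulatedEnergy, h.totalMass_const hT ht, h.intT3_modulated_velocity hR ht,
    h.intT3_modulated_u ht, EuclideanSpace.real_norm_sq_eq]
  simp only [PiLp.sub_apply, PiLp.smul_apply, smul_eq_mul, h.meanVelocity_apply ht,
    h.meanMomentum_apply hR ht]
  generalize totalMass f 0 = ρ at *
  generalize (∫ z in phaseSet R, f t z.1 z.2) = M at *
  generalize ((2 * π) ^ 3)⁻¹ = c at *
  subst hm
  have hne : c * M ≠ 0 := hmass.ne'
  congr 2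
  · congr 1
    have hc : c ≠ 0 := left_ne_zero_of_mul hne
    have hM : M ≠ 0 := right_ne_zero_of_mul hne
    simp only [Fin.sum_univ_three]
    field_simp
    ring
  · congr 1
    simp only [Fin.sum_univ_three]
    ring

lemma dissipationVNS_eq (h : IsClassicalVNS ε γ σ T u p f) {R : ℝ}
    (hR : ∀ t ∈ Set.Icc (0:ℝ) T, ∀ (x v : E3), R ≤ ‖v‖ → f t x v = 0)
    {t : ℝ} (ht : t ∈ Set.Icc (0:ℝ) T) :
    dissipationVNS γ σ u f t
      = ((2 * π) ^ 3)⁻¹ * (∫ x in cube3, ∑ i, ∑ j, fderiv ℝ (fun y => u t y i) x (e3 j) ^ 2)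
        + γ⁻¹ * (((2 * π) ^ 3)⁻¹ *
          ∫ z in phaseSet R, (∑ i, (σ⁻¹ * z.2 i - u t z.1 i) ^ 2) * f t z.1 z.2) := by
  have hc : Continuous fun z : E3 × E3 =>
      (∑ i, (σ⁻¹ * z.2 i - u t z.1 i) ^ 2) * f t z.1 z.2 :=
    h.continuous_phase_f ht (continuous_finsetSum _ fun i _ => (h.continuous_slip ht i).pow 2)
  rw [dissipationVNS, ← setIntegral_cube3_integral (R := R) hc (fun x v hv => by
    rw [hR t ht x v hv.le, mul_zero])]
  simp only [intT3, EuclideanSpace.real_norm_sq_eq, PiLp.sub_apply, PiLp.smul_apply, smul_eq_mul]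

lemma dissipationVNS_nonneg (h : IsClassicalVNS ε γ σ T u p f) (hγ : 0 < γ)
    {t : ℝ} (ht : t ∈ Set.Icc (0:ℝ) T) : 0 ≤ dissipationVNS γ σ u f t := by
  have hπ := Real.pi_pos
  refine add_nonneg (mul_nonneg (by positivity) (integral_nonneg fun x => by positivity))
    (mul_nonneg (by positivity) (mul_nonneg (by positivity) (integral_nonneg fun x =>
      integral_nonneg fun v => mul_nonneg (by positivity) (h.f_nonneg t ht x v))))

lemma hasDerivWithinAt_modulatedEnergy (h : IsClassicalVNS ε γ σ T u p f)
    (hε : 0 < ε) (hγ : 0 < γ) (hσ : 0 < σ) (hT : 0 < T) (hmass : 0 < totalMass f 0)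
    {t : ℝ} (ht : t ∈ Set.Icc (0:ℝ) T) :
    HasDerivWithinAt (modulatedEnergy ε γ σ u f) (-(dissipationVNS γ σ u f t))
      (Set.Icc 0 T) t := by
  obtain ⟨R, -, hR⟩ := h.f_compact_supp
  refine HasDerivWithinAt.congr_of_mem ?_ (fun s hs => h.modulatedEnergy_eq hT hR hmass hs) ht
  have hP := h.hasDerivWithinAt_momentum hT hσ hR ht
  have hW := h.hasDerivWithinAt_mean_u hT hR ht
  have hK := h.hasDerivWithinAt_energy_f hT hσ hR ht
  have hV := h.hasDerivWithinAt_energy_u hT hR ht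
  have hP' := fun i => ((hP i).const_mul σ⁻¹).const_mul ((2 * π) ^ 3)⁻¹
  have hW' := fun i => (hW i).const_mul ((2 * π) ^ 3)⁻¹
  have hd := ((((hK.const_mul (((2 * π) ^ 3)⁻¹ * σ⁻¹ ^ 2)).fun_sub
      ((HasDerivWithinAt.fun_sum (u := Finset.univ) fun i _ => (hP' i).fun_pow 2).const_mul
        (totalMass f 0)⁻¹)).const_mul (ε / (2 * γ))).fun_add
    (((hV.const_mul ((2 * π) ^ 3)⁻¹).fun_sub
      (HasDerivWithinAt.fun_sum (u := Finset.univ) fun i _ => (hW' i).fun_pow 2)).const_mul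
        (1 / 2))).fun_add
    ((HasDerivWithinAt.fun_sum (u := Finset.univ) fun i _ =>
      (((hP' i).const_mul (totalMass f 0)⁻¹).fun_sub (hW' i)).fun_pow 2).const_mul
        (ε * totalMass f 0 / (2 * (γ + ε * totalMass f 0))))
  refine hd.congr_deriv ?_
  clear hd hW' hP' hV hK hW hP
  rw [h.dissipationVNS_eq hR ht]
  have hc : ((2 * π) ^ 3)⁻¹ ≠ 0 := by have := Real.pi_pos; positivity
  have hden : γ + ε * totalMass f 0 ≠ 0 := by positivity
  have hρ := hmass.ne'
  simp only [Nat.cast_ofNat, Nat.add_one_sub_one, pow_one]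
  generalize (∫ z in phaseSet R, (∑ i, (σ⁻¹ * z.2 i - u t z.1 i) ^ 2) * f t z.1 z.2) = S
  generalize (∫ z in phaseSet R,
    (∑ i, u t z.1 i * (σ⁻¹ * z.2 i - u t z.1 i)) * f t z.1 z.2) = Q
  generalize (∫ x in cube3, ∑ i, ∑ j, fderiv ℝ (fun y => u t y i) x (e3 j) ^ 2) = G
  simp only [Fin.sum_univ_three]
  generalize totalMass f 0 = ρ at hρ hden ⊢
  generalize ((2 * π) ^ 3)⁻¹ = c at hc ⊢
  field_simp
  ring

end IsClassicalVNS

/-- **Modulated energy–dissipation identity** (Statement 4, classical form of Lemma 3.8).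
Let `ε, γ, σ > 0`, `T > 0` and let `(u, p, f)` be a classical solution of the scaled
Vlasov–Navier–Stokes system with parameters `ε, γ, σ` on `[0,T]` with positive total mass
`ρ̄ = ∫_{𝕋³×ℝ³} f(0,x,v) dx dv > 0`.  Then the modulated energy `𝓔` is differentiable
on `[0,T]` and `𝓔′(t) + D(t) = 0` for every `t ∈ [0,T]`; in particular
`𝓔(t) + ∫ₛᵗ D(τ) dτ = 𝓔(s)` for all `0 ≤ s ≤ t ≤ T`. -/
theorem modulated_energy_dissipation_identity
    (ε γ σ T : ℝ) (hε : 0 < ε) (hγ : 0 < γ) (hσ : 0 < σ) (hT : 0 < T)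
    (u : ℝ → E3 → E3) (p : ℝ → E3 → ℝ) (f : ℝ → E3 → E3 → ℝ)
    (hsol : IsClassicalVNS ε γ σ T u p f)
    (hmass : 0 < totalMass f 0) :
    (∀ t ∈ Set.Icc (0:ℝ) T,
      HasDerivWithinAt (modulatedEnergy ε γ σ u f) (-(dissipationVNS γ σ u f t))
        (Set.Icc 0 T) t)
    ∧ ∀ s t : ℝ, 0 ≤ s → s ≤ t → t ≤ T →
        modulatedEnergy ε γ σ u f t + ∫ τ in s..t, dissipationVNS γ σ u f τ
          = modulatedEnergy ε γ σ u f s := by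
  have hderiv := fun t (ht : t ∈ Set.Icc (0:ℝ) T) =>
    hsol.hasDerivWithinAt_modulatedEnergy hε hγ hσ hT hmass ht
  refine ⟨hderiv, fun s t hs hst htT => ?_⟩
  have hsub : Set.Icc s t ⊆ Set.Icc 0 T := Set.Icc_subset_Icc hs htT
  have hcont : ContinuousOn (fun τ => -modulatedEnergy ε γ σ u f τ) (Set.Icc s t) :=
    fun τ hτ => ((hderiv τ (hsub hτ)).continuousWithinAt.mono hsub).neg
  have hd : ∀ τ ∈ Set.Ioo s t, HasDerivAt (fun τ => -modulatedEnergy ε γ σ u f τ)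
      (dissipationVNS γ σ u f τ) τ := by
    intro τ hτ
    have h1 := (hderiv τ (hsub ⟨hτ.1.le, hτ.2.le⟩)).hasDerivAt
      (Icc_mem_nhds (hs.trans_lt hτ.1) (hτ.2.trans_le htT))
    simpa using h1.fun_neg
  have hint : IntervalIntegrable (fun τ => dissipationVNS γ σ u f τ) volume s t :=
    (intervalIntegrable_iff_integrableOn_Ioc_of_le hst).2
      (intervalIntegral.integrableOn_deriv_of_nonneg hcont hd fun τ hτ =>
        hsol.dissipationVNS_nonneg hγ (hsub ⟨hτ.1.le, hτ.2.le⟩))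
  rw [intervalIntegral.integral_eq_sub_of_hasDerivAt_of_le hst hcont hd hint]
  ring
end
end

section
/- Differential inequality for the third velocity moment (equation (3.4) in the proof of Lemma 3.4, classical form): let ε, σ > 0 and T > 0. Let u: [0,T]×ℝ³ → ℝ³ be continuous and 2π-periodic in each space coordinate, and let f: [0,T]×ℝ³×ℝ³ → [0,∞) be C¹, 2π-periodic in x, vanishing whenever |v| ≥ R₀ for some fixed R₀ > 0, and satisfy pointwise ∂ₜf + (1/σ) v·∇ₓf + (1/ε) div_v[f(σu − v)] = 0. Set M₃(t) := ∫_{𝕋³×ℝ³} |v|³ f(t,x,v) dx dv and m₂f(t,x) := ∫_{ℝ³} |v|² f(t,x,v) dv. Then M₃ is differentiable on [0,T] and, for every t ∈ [0,T], M₃′(t) + (3/ε) M₃(t) ≤ (3σ/ε) ∫_{𝕋³} |u(t,x)| m₂f(t,x) dx. -/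
noncomputable section

open MeasureTheory Real

lemma cube3_eq_preimage_Icc :
    cube3 = WithLp.ofLp ⁻¹' Set.Icc (0 : Fin 3 → ℝ) (fun _ => 2 * π) := by
  ext x
  simp [cube3, Set.mem_Icc, Pi.le_def, forall_and]

lemma hasCompactSupport_of_le_norm {g : E3 → ℝ} {R : ℝ} (hs : ∀ v, R ≤ ‖v‖ → g v = 0) :
    HasCompactSupport g :=
  HasCompactSupport.intro (isCompact_closedBall (0 : E3) R) fun v hv =>
    hs v (by simpa using (not_le.1 fun h => hv (by simpa using h)).le)

/-- A `C¹` function that is `2π`-periodic in each coordinate has directional derivatives of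
vanishing mean over the fundamental cube. -/
lemma setIntegral_cube3_sum_fderiv_eq_zero {g : E3 → ℝ} (hg : ContDiff ℝ 1 g)
    (hper : ∀ (x : E3) (i : Fin 3), g (x + (2 * π) • e3 i) = g x) (a : E3) :
    ∫ x in cube3, ∑ i, a i * fderiv ℝ g x (e3 i) = 0 := by
  let L : (Fin 3 → ℝ) →L[ℝ] E3 := (EuclideanSpace.equiv (Fin 3) ℝ).symm.toContinuousLinearMap
  have hL : ∀ y, L y = WithLp.toLp 2 y := fun _ => rfl
  have hderiv : ∀ (y : Fin 3 → ℝ) (i : Fin 3), HasFDerivAt (fun y => a i * g (L y))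
      (a i • (fderiv ℝ g (L y)).comp L) y := fun y i =>
    (((hg.differentiable one_ne_zero) (L y)).hasFDerivAt.comp y L.hasFDerivAt).const_mul (a i)
  have hcont : Continuous (fderiv ℝ g) := hg.continuous_fderiv one_ne_zero
  have key := integral_divergence_of_hasFDerivAt_off_countable' (0 : Fin 3 → ℝ)
    (fun _ => 2 * π) (fun _ => two_pi_pos.le) (fun i y => a i * g (L y))
    (fun i y => a i • (fderiv ℝ g (L y)).comp L) ∅ Set.countable_empty
    (fun i => (continuous_const.mul (hg.continuous.comp L.continuous)).continuousOn)
    (fun y _ i => hderiv y i)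
    (by
      refine Continuous.integrableOn_Icc ?_
      refine continuous_finsetSum _ fun i _ => ?_
      exact continuous_const.mul ((hcont.comp L.continuous).clm_apply continuous_const))
  have hface : ∀ (i : Fin 3) (x : Fin 2 → ℝ),
      g (L (i.insertNth (2 * π) x)) = g (L (i.insertNth 0 x)) := fun i x => by
    rw [← hper (L (i.insertNth 0 x)) i]
    congr 1
    ext j
    refine Fin.succAboveCases i ?_ (fun k => ?_) j <;> simp [hL, e3]
  have htransfer : ∫ x in cube3, ∑ i, a i * fderiv ℝ g x (e3 i)
      = ∫ y in Set.Icc (0 : Fin 3 → ℝ) (fun _ => 2 * π),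
        ∑ i, a i * fderiv ℝ g (L y) (e3 i) := by
    rw [cube3_eq_preimage_Icc, ← (PiLp.volume_preserving_ofLp (Fin 3)).setIntegral_preimage_emb
      (MeasurableEquiv.toLp 2 (Fin 3 → ℝ)).symm.measurableEmbedding]
    rfl
  rw [htransfer]
  refine Eq.trans ?_ (key.trans (Finset.sum_eq_zero fun i _ => ?_))
  · rfl
  · simp only [hface, Pi.zero_apply, sub_self]

/-- A continuous function on phase space with velocities of bounded size is integrable over one
spatial period. -/
lemma integrable_cube3_prod {g : E3 → E3 → ℝ} {R : ℝ}
    (hg : Continuous (Function.uncurry g)) (hs : ∀ x v, R ≤ ‖v‖ → g x v = 0) :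
    Integrable (Function.uncurry g)
      ((volume.restrict cube3).prod (volume : Measure E3)) := by
  have hK : IsCompact (cube3 ×ˢ Metric.closedBall (0 : E3) R) :=
    isCompact_cube3.prod (isCompact_closedBall 0 R)
  have h1 := hg.continuousOn.integrableOn_compact (μ := (volume : Measure (E3 × E3))) hK
  rw [IntegrableOn, Measure.volume_eq_prod, ← Measure.prod_restrict] at h1
  have h2 : (volume.restrict cube3).prod (volume.restrict (Metric.closedBall (0 : E3) R))
      = ((volume.restrict cube3).prod volume).restrict
        (Set.univ ×ˢ Metric.closedBall (0 : E3) R) := by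
    rw [← Measure.prod_restrict, Measure.restrict_univ]
  rw [h2] at h1
  refine (integrableOn_iff_integrable_of_support_subset ?_).1 h1
  rintro ⟨x, v⟩ h
  refine ⟨trivial, ?_⟩
  by_contra hv
  exact h (hs x v (by simpa using (not_le.1 fun h' => hv (by simpa using h')).le))

lemma hasFDerivAt_norm_pow_three (v : E3) :
    HasFDerivAt (fun v : E3 => ‖v‖ ^ 3) ((3 * ‖v‖) • innerSL ℝ v) v := by
  have h := hasFDerivAt_norm_rpow v (p := 3) (by norm_num)
  norm_num at h
  exact h

open Filter Topology in
/-- Velocity moments of a compactly supported solution may be differentiated in time under the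
integral, including one-sidedly at the end points. -/
lemma hasDerivWithinAt_integral_moment {T R : ℝ} (hT : 0 < T) {f : ℝ → E3 → E3 → ℝ}
    (hf : ContDiffOn ℝ 1 (fun q : ℝ × E3 × E3 => f q.1 q.2.1 q.2.2)
      (Set.Icc 0 T ×ˢ (Set.univ : Set (E3 × E3))))
    (hs : ∀ t ∈ Set.Icc (0 : ℝ) T, ∀ x v : E3, R ≤ ‖v‖ → f t x v = 0)
    {w : E3 → ℝ} (hw : Continuous w) {t : ℝ} (ht : t ∈ Set.Icc 0 T) :
    Continuous (fun p : E3 × E3 =>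
        derivWithin (fun s => f s p.1 p.2) (Set.Icc 0 T) t) ∧
      (∀ x v : E3, R ≤ ‖v‖ → derivWithin (fun s => f s x v) (Set.Icc 0 T) t = 0) ∧
      HasDerivWithinAt (fun s => ∫ x in cube3, ∫ v : E3, w v * f s x v)
        (∫ x in cube3, ∫ v : E3, w v * derivWithin (fun s => f s x v) (Set.Icc 0 T) t)
        (Set.Icc 0 T) t := by
  set S := Set.Icc (0 : ℝ) T
  have hSu : UniqueDiffOn ℝ S := uniqueDiffOn_Icc hT
  have hU : UniqueDiffOn ℝ (S ×ˢ (Set.univ : Set (E3 × E3))) := hSu.prod uniqueDiffOn_univ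
  set F : ℝ × E3 × E3 → ℝ := fun q => f q.1 q.2.1 q.2.2
  have hderiv : ∀ s ∈ S, ∀ x v : E3, HasDerivWithinAt (fun s => f s x v)
      (fderivWithin ℝ F (S ×ˢ Set.univ) (s, x, v) (1, 0, 0)) S s := by
    intro s hs' x v
    have h1 := ((hf.differentiableOn one_ne_zero) (s, x, v) ⟨hs', trivial⟩).hasFDerivWithinAt
    have h2 : HasDerivWithinAt (fun s : ℝ => (s, x, v)) ((1 : ℝ), (0 : E3), (0 : E3)) S s :=
      (hasDerivWithinAt_id s S).prodMk (hasDerivWithinAt_const s S (x, v))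
    exact h1.comp_hasDerivWithinAt s h2 (fun r hr => Set.mk_mem_prod hr (Set.mem_univ _))
  have hcont : ContinuousOn
      (fun q : ℝ × E3 × E3 => derivWithin (fun s => f s q.2.1 q.2.2) S q.1)
      (S ×ˢ Set.univ) := by
    refine ((hf.continuousOn_fderivWithin hU le_rfl).clm_apply
      (continuousOn_const (c := ((1 : ℝ), (0 : E3), (0 : E3))))).congr ?_
    rintro ⟨s, x, v⟩ ⟨hs', -⟩
    exact (hderiv s hs' x v).derivWithin (hSu s hs')
  have hzero : ∀ s ∈ S, ∀ x v : E3, R ≤ ‖v‖ → derivWithin (fun s => f s x v) S s = 0 := by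
    intro s hs' x v hv
    rw [derivWithin_congr (f := fun _ => (0 : ℝ)) (fun r hr => hs r hr x v hv) (hs s hs' x v hv)]
    simp
  have hcont_t : ∀ s ∈ S, Continuous (Function.uncurry (f s)) := fun s hs' =>
    hf.continuousOn.comp_continuous (f := fun p : E3 × E3 => (s, p)) (by fun_prop)
      (fun p => Set.mk_mem_prod hs' (Set.mem_univ p))
  have hDcont : Continuous (fun p : E3 × E3 => derivWithin (fun s => f s p.1 p.2) S t) :=
    hcont.comp_continuous (f := fun p : E3 × E3 => (t, p)) (by fun_prop)
      (fun p => Set.mk_mem_prod ht (Set.mem_univ p))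
  refine ⟨hDcont, hzero t ht, ?_⟩
  obtain ⟨C, hC⟩ := (isCompact_Icc.prod (isCompact_cube3.prod
    (isCompact_closedBall (0 : E3) R))).exists_bound_of_continuousOn
      (hcont.mono (Set.prod_mono_right (Set.subset_univ (cube3 ×ˢ Metric.closedBall 0 R))))
  have hbound : ∀ s ∈ S, ∀ x ∈ cube3, ∀ v : E3,
      ‖derivWithin (fun s => f s x v) S s‖ ≤ |C| * max 0 (R + 1 - ‖v‖) := by
    intro s hs' x hx v
    rcases le_total R ‖v‖ with h | h
    · rw [hzero s hs' x v h, norm_zero]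
      positivity
    · refine (hC (s, x, v) ⟨hs', hx, by simpa using h⟩).trans ((le_abs_self C).trans ?_)
      exact le_mul_of_one_le_right (abs_nonneg C) (le_max_of_le_right (by linarith))
  set μ : Measure (E3 × E3) := (volume.restrict cube3).prod volume
  have hcube : ∀ᵐ p ∂μ, p.1 ∈ cube3 :=
    Measure.quasiMeasurePreserving_fst.ae (ae_restrict_mem isCompact_cube3.measurableSet)
  have hint : ∀ s ∈ S, Integrable (Function.uncurry fun x v => w v * f s x v) μ := fun s hs' =>
    integrable_cube3_prod (R := R) ((hw.comp continuous_snd).mul (hcont_t s hs'))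
      (fun x v hv => by rw [hs s hs' x v hv, mul_zero])
  have hintD : Integrable
      (Function.uncurry fun x v => w v * derivWithin (fun s => f s x v) S t) μ :=
    integrable_cube3_prod (R := R) ((hw.comp continuous_snd).mul hDcont)
      (fun x v hv => by rw [hzero t ht x v hv, mul_zero])
  rw [integral_integral hintD]
  have hprod : Set.EqOn (fun s => ∫ x in cube3, ∫ v : E3, w v * f s x v)
      (fun s => ∫ p, w p.2 * f s p.1 p.2 ∂μ) S := fun s hs' => integral_integral (hint s hs')
  refine HasDerivWithinAt.congr ?_ hprod (hprod ht)
  rw [hasDerivWithinAt_iff_tendsto_slope]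
  have hmem : ∀ᶠ s in 𝓝[S \ {t}] t, s ∈ S \ {t} := self_mem_nhdsWithin
  have hslope : ∀ᶠ s in 𝓝[S \ {t}] t,
      ∫ p, w p.2 * slope (fun s => f s p.1 p.2) t s ∂μ =
        slope (fun s => ∫ p, w p.2 * f s p.1 p.2 ∂μ) t s := by
    filter_upwards [hmem] with s hs'
    have h := integral_sub (hint s hs'.1) (hint t ht)
    simp only [Function.uncurry_def] at h
    rw [slope_def_field, ← h, ← integral_div]
    refine integral_congr_ae (.of_forall fun p => ?_)
    simp only [slope_def_field]
    ring
  refine Tendsto.congr' hslope (tendsto_integral_filter_of_dominated_convergence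
    (fun p => |w p.2| * (|C| * max 0 (R + 1 - ‖p.2‖))) ?_ ?_ ?_ ?_)
  · filter_upwards [hmem] with s hs'
    simp only [slope_def_field]
    exact ((hw.comp continuous_snd).mul
      (((hcont_t s hs'.1).sub (hcont_t t ht)).div_const _)).aestronglyMeasurable
  · filter_upwards [hmem] with s hs'
    filter_upwards [hcube] with p hp
    rw [norm_mul, Real.norm_eq_abs (w p.2)]
    gcongr
    have hlip := (convex_Icc (0 : ℝ) T).norm_image_sub_le_of_norm_derivWithin_le
      (f := fun s => f s p.1 p.2) (fun r hr => (hderiv r hr p.1 p.2).differentiableWithinAt)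
      (fun r hr => hbound r hr p.1 hp p.2) ht hs'.1
    rw [slope_def_field, norm_div]
    exact div_le_of_le_mul₀ (norm_nonneg _) (by positivity) hlip
  · exact integrable_cube3_prod (g := fun _ v => |w v| * (|C| * max 0 (R + 1 - ‖v‖))) (R := R + 1)
      (by simp only [Function.uncurry_def]; fun_prop)
      (fun x v hv => by rw [max_eq_left (by linarith)]; simp)
  · refine .of_forall fun p => ?_
    have h := (hderiv t ht p.1 p.2).differentiableWithinAt.hasDerivWithinAt
    exact (hasDerivWithinAt_iff_tendsto_slope.1 h).const_mul _

/-- Integrating the velocity divergence `div_v[g(b - v)]` against `|v|³`. -/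
lemma integral_norm_pow_three_mul_div {g : E3 → ℝ} {R : ℝ} (hg : ContDiff ℝ 1 g)
    (hs : ∀ v, R ≤ ‖v‖ → g v = 0) (b : E3) :
    ∫ v, ‖v‖ ^ 3 * ∑ i, fderiv ℝ (fun w => g w * (b i - w i)) v (e3 i)
      = -∫ v, 3 * ‖v‖ * inner ℝ v (b - v) * g v := by
  have hsupp := hasCompactSupport_of_le_norm hs
  have hcoord : ∀ i, ContDiff ℝ 1 (fun w : E3 => b i - w i) := fun i => by fun_prop
  have hh : ∀ i, ContDiff ℝ 1 (fun w => g w * (b i - w i)) := fun i => hg.mul (hcoord i)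
  have hhs : ∀ i, HasCompactSupport (fun w => g w * (b i - w i)) := fun i => hsupp.mul_right
  have hfd : ∀ (v : E3) i,
      fderiv ℝ (fun v : E3 => ‖v‖ ^ 3) v (e3 i) = 3 * ‖v‖ * v i := fun v i => by
    rw [(hasFDerivAt_norm_pow_three v).fderiv]
    simp [e3, EuclideanSpace.inner_single_right]
  have hdint : ∀ i, Integrable
      (fun v => ‖v‖ ^ 3 * fderiv ℝ (fun w => g w * (b i - w i)) v (e3 i)) := fun i => by
    refine Continuous.integrable_of_hasCompactSupport ?_ ?_
    · exact (continuous_norm.pow 3).mul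
        (((hh i).continuous_fderiv one_ne_zero).clm_apply continuous_const)
    · exact ((hhs i).fderiv_apply ℝ (e3 i)).mul_left
  have hint : ∀ i, Integrable
      (fun v => fderiv ℝ (fun v : E3 => ‖v‖ ^ 3) v (e3 i) * (g v * (b i - v i))) := fun i => by
    simp only [hfd]
    refine Continuous.integrable_of_hasCompactSupport ?_ (hhs i).mul_left
    have := (hh i).continuous
    fun_prop
  have hparts : ∀ i, ∫ v, ‖v‖ ^ 3 * fderiv ℝ (fun w => g w * (b i - w i)) v (e3 i)
      = -∫ v, fderiv ℝ (fun v : E3 => ‖v‖ ^ 3) v (e3 i) * (g v * (b i - v i)) := fun i =>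
    integral_mul_fderiv_eq_neg_fderiv_mul_of_integrable (hint i) (hdint i)
      (((continuous_norm.pow 3).mul (hh i).continuous).integrable_of_hasCompactSupport
        (hhs i).mul_left)
      (fun v _ => (hasFDerivAt_norm_pow_three v).differentiableAt)
      (fun v _ => (hh i).differentiable one_ne_zero v)
  simp only [Finset.mul_sum]
  rw [integral_finsetSum _ (fun i _ => hdint i), Finset.sum_congr rfl (fun i _ => hparts i),
    Finset.sum_neg_distrib, ← integral_finsetSum _ (fun i _ => hint i)]
  congr 2
  ext v
  simp only [hfd, PiLp.inner_apply, PiLp.sub_apply, RCLike.inner_apply, conj_trivial,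
    Finset.mul_sum, Finset.sum_mul]
  exact Finset.sum_congr rfl fun i _ => by ring

lemma neg_integral_norm_pow_three_mul_div_le {g : E3 → ℝ} {R : ℝ} (hg : ContDiff ℝ 1 g)
    (hpos : ∀ v, 0 ≤ g v) (hs : ∀ v, R ≤ ‖v‖ → g v = 0) (b : E3) :
    -∫ v, ‖v‖ ^ 3 * ∑ i, fderiv ℝ (fun w => g w * (b i - w i)) v (e3 i)
      ≤ 3 * (‖b‖ * ∫ v, ‖v‖ ^ 2 * g v) - 3 * ∫ v, ‖v‖ ^ 3 * g v := by
  have hsupp := hasCompactSupport_of_le_norm hs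
  have hint : ∀ {w : E3 → ℝ}, Continuous w → Integrable (fun v => w v * g v) := fun hw =>
    (hw.mul hg.continuous).integrable_of_hasCompactSupport hsupp.mul_left
  have h2 := hint (w := fun v => ‖v‖ ^ 2) (by fun_prop)
  have h3 := hint (w := fun v => ‖v‖ ^ 3) (by fun_prop)
  rw [integral_norm_pow_three_mul_div hg hs b, neg_neg, ← mul_assoc, ← integral_const_mul,
    ← integral_const_mul, ← integral_sub (h2.const_mul _) (h3.const_mul _)]
  refine integral_mono (hint (w := fun v => 3 * ‖v‖ * inner ℝ v (b - v)) (by fun_prop))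
    ((h2.const_mul _).sub (h3.const_mul _)) fun v => ?_
  have hcs : inner ℝ v (b - v) ≤ ‖v‖ * ‖b‖ - ‖v‖ ^ 2 := by
    rw [inner_sub_right, real_inner_self_eq_norm_sq]
    linarith [real_inner_le_norm v b]
  calc 3 * ‖v‖ * inner ℝ v (b - v) * g v
      ≤ 3 * ‖v‖ * (‖v‖ * ‖b‖ - ‖v‖ ^ 2) * g v := by
        gcongr
        exact hpos v
    _ = 3 * ‖b‖ * (‖v‖ ^ 2 * g v) - 3 * (‖v‖ ^ 3 * g v) := by ring

/-- **Differential inequality for the third velocity moment** (Statement 7, classical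
form of equation (3.4)).  Let `ε, σ > 0`, `T > 0`, let `u` be continuous on `[0,T]×ℝ³`
and `2π`-periodic in each space coordinate, and let `f ≥ 0` be `C¹`, `2π`-periodic in
`x`, vanishing for `|v| ≥ R₀`, and satisfy the Vlasov equation
`∂ₜf + (1/σ) v·∇ₓf + (1/ε) div_v[f(σu − v)] = 0` pointwise on `[0,T]×ℝ³×ℝ³`.
Then `M₃(t) := ∫_{𝕋³×ℝ³} |v|³ f(t,x,v) dx dv` is differentiable on `[0,T]` and
`M₃′(t) + (3/ε) M₃(t) ≤ (3σ/ε) ∫_{𝕋³} |u(t,x)| m₂f(t,x) dx` for every `t ∈ [0,T]`,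
where `m₂f(t,x) := ∫_{ℝ³} |v|² f(t,x,v) dv`. -/
theorem third_moment_differential_inequality
    (ε σ T : ℝ) (hε : 0 < ε) (hσ : 0 < σ) (hT : 0 < T)
    (u : ℝ → E3 → E3) (f : ℝ → E3 → E3 → ℝ)
    (hu_cont : ContinuousOn (fun q : ℝ × E3 => u q.1 q.2) (Set.Icc 0 T ×ˢ Set.univ))
    (hu_per : ∀ t ∈ Set.Icc (0:ℝ) T, ∀ (x : E3) (i : Fin 3),
      u t (x + (2 * π) • e3 i) = u t x)
    (hf_nonneg : ∀ t ∈ Set.Icc (0:ℝ) T, ∀ (x v : E3), 0 ≤ f t x v)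
    (hf_reg : ContDiffOn ℝ 1 (fun q : ℝ × E3 × E3 => f q.1 q.2.1 q.2.2)
      (Set.Icc 0 T ×ˢ (Set.univ : Set (E3 × E3))))
    (hf_per : ∀ t ∈ Set.Icc (0:ℝ) T, ∀ (x v : E3) (i : Fin 3),
      f t (x + (2 * π) • e3 i) v = f t x v)
    (hf_supp : ∃ R₀ > (0:ℝ), ∀ t ∈ Set.Icc (0:ℝ) T, ∀ (x v : E3), R₀ ≤ ‖v‖ → f t x v = 0)
    (hvlasov : ∀ t ∈ Set.Icc (0:ℝ) T, ∀ (x v : E3),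
      derivWithin (fun s => f s x v) (Set.Icc 0 T) t
        + σ⁻¹ * ∑ i, v i * fderiv ℝ (fun y => f t y v) x (e3 i)
        + ε⁻¹ * ∑ i, fderiv ℝ (fun w => f t x w * (σ * u t x i - w i)) v (e3 i) = 0) :
    ∀ t ∈ Set.Icc (0:ℝ) T,
      DifferentiableWithinAt ℝ
        (fun s => intT3 (fun x => ∫ v : E3, ‖v‖ ^ 3 * f s x v)) (Set.Icc 0 T) t
      ∧ derivWithin (fun s => intT3 (fun x => ∫ v : E3, ‖v‖ ^ 3 * f s x v))
            (Set.Icc 0 T) t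
          + 3 / ε * intT3 (fun x => ∫ v : E3, ‖v‖ ^ 3 * f t x v)
        ≤ 3 * σ / ε * intT3 (fun x => ‖u t x‖ * ∫ v : E3, ‖v‖ ^ 2 * f t x v) := by
  obtain ⟨R, -, hs⟩ := hf_supp
  intro t ht
  obtain ⟨hDcont, hDzero, hderiv⟩ := hasDerivWithinAt_integral_moment hT hf_reg hs
    (w := fun v => ‖v‖ ^ 3) (by fun_prop) ht
  have hM := hderiv.const_mul ((2 * π) ^ 3)⁻¹
  refine ⟨hM.differentiableWithinAt, ?_⟩
  have hM' : derivWithin (fun s => intT3 (fun x => ∫ v : E3, ‖v‖ ^ 3 * f s x v))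
      (Set.Icc 0 T) t = _ := hM.derivWithin (uniqueDiffOn_Icc hT t ht)
  rw [hM']
  have hg : ContDiff ℝ 1 (fun p : E3 × E3 => f t p.1 p.2) := by
    rw [← contDiffOn_univ]
    exact hf_reg.comp (f := fun p : E3 × E3 => (t, p)) (by fun_prop)
      (fun p _ => Set.mk_mem_prod ht (Set.mem_univ p))
  have hgx : ∀ v, ContDiff ℝ 1 (fun x => f t x v) := fun v => by fun_prop
  have hgv : ∀ x, ContDiff ℝ 1 (f t x) := fun x =>
    hg.comp (f := fun v => (x, v)) (by fun_prop)
  have hu : Continuous (u t) :=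
    hu_cont.comp_continuous (f := fun x => (t, x)) (by fun_prop)
      (fun x => Set.mk_mem_prod ht (Set.mem_univ x))
  set D : E3 → E3 → ℝ := fun x v => derivWithin (fun s => f s x v) (Set.Icc 0 T) t with hD
  set X : E3 → E3 → ℝ := fun x v => ∑ i, v i * fderiv ℝ (fun y => f t y v) x (e3 i) with hX
  set V : E3 → E3 → ℝ :=
    fun x v => ∑ i, fderiv ℝ (fun w => f t x w * (σ * u t x i - w i)) v (e3 i)
  have hpde : ∀ x v, D x v + σ⁻¹ * X x v + ε⁻¹ * V x v = 0 := hvlasov t ht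
  have hVeq : ∀ x v, V x v = -ε * (D x v + σ⁻¹ * X x v) := fun x v => by
    have h := hpde x v
    field_simp at h ⊢
    linarith
  have hXcont : Continuous (Function.uncurry X) := by
    have hfd : ∀ (x v : E3) i, fderiv ℝ (fun y => f t y v) x (e3 i)
        = fderiv ℝ (fun p : E3 × E3 => f t p.1 p.2) (x, v) (e3 i, 0) := fun x v i => by
      have h1 := (hg.differentiable one_ne_zero (x, v)).hasFDerivAt
      have h2 := h1.comp (f := fun y => (y, v)) x
        ((hasFDerivAt_id x).prodMk (hasFDerivAt_const v x))
      have h3 : fderiv ℝ (fun y => f t y v) x = _ := h2.fderiv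
      rw [h3]
      rfl
    simp only [hX, hfd, Function.uncurry_def]
    have := hg.continuous_fderiv one_ne_zero
    fun_prop
  have hXzero : ∀ x v, R ≤ ‖v‖ → X x v = 0 := fun x v hv => by
    have h : (fun y => f t y v) = fun _ => 0 := funext fun y => hs t ht y v hv
    simp [hX, h]
  have hVcont : Continuous (Function.uncurry V) := by
    have h : Function.uncurry V
        = fun p => -ε * (Function.uncurry D p + σ⁻¹ * Function.uncurry X p) :=
      funext fun p => hVeq p.1 p.2
    rw [h]
    exact continuous_const.mul (Continuous.add hDcont (continuous_const.mul hXcont))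
  have hVzero : ∀ x v, R ≤ ‖v‖ → V x v = 0 := fun x v hv => by
    rw [hVeq, hXzero x v hv, hD]
    simp [hDzero x v hv]
  have hint : ∀ {G : E3 → E3 → ℝ} {w : E3 → ℝ}, Continuous w → Continuous (Function.uncurry G) →
      (∀ x v, R ≤ ‖v‖ → G x v = 0) → Integrable (Function.uncurry fun x v => w v * G x v)
        ((volume.restrict cube3).prod volume) := fun hw hG hz =>
    integrable_cube3_prod (R := R) ((hw.comp continuous_snd).mul hG)
      (fun x v hv => by rw [hz x v hv, mul_zero])
  have hw2 : Continuous (fun v : E3 => ‖v‖ ^ 2) := by fun_prop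
  have hw3 : Continuous (fun v : E3 => ‖v‖ ^ 3) := by fun_prop
  have hIX := hint hw3 hXcont hXzero
  have hIV := hint hw3 hVcont hVzero
  have hI2 := hint hw2 hg.continuous (hs t ht)
  have hI3 := hint hw3 hg.continuous (hs t ht)
  have htransport : ∫ x in cube3, ∫ v, ‖v‖ ^ 3 * X x v = 0 := by
    rw [integral_integral_swap hIX]
    simp only [hX, integral_const_mul,
      setIntegral_cube3_sum_fderiv_eq_zero (hgx _) (fun x i => hf_per t ht x _ i),
      mul_zero, integral_zero]
  have hsplit : ∫ x in cube3, ∫ v, ‖v‖ ^ 3 * D x v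
      = ε⁻¹ * ∫ x in cube3, -∫ v, ‖v‖ ^ 3 * V x v := by
    have hDeq : ∀ x v, ‖v‖ ^ 3 * D x v
        = -σ⁻¹ * (‖v‖ ^ 3 * X x v) - ε⁻¹ * (‖v‖ ^ 3 * V x v) := fun x v => by
      linear_combination ‖v‖ ^ 3 * hpde x v
    simp only [hDeq]
    have h := integral_integral_sub (hIX.const_mul (-σ⁻¹)) (hIV.const_mul ε⁻¹)
    simp only [Function.uncurry_apply_pair] at h
    rw [h]
    simp only [integral_const_mul, htransport, integral_neg]
    ring
  have hm2 : IntegrableOn (fun x => ‖u t x‖ * ∫ v, ‖v‖ ^ 2 * f t x v) cube3 := by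
    have h := integrable_cube3_prod (R := R) (g := fun x v => ‖u t x‖ * (‖v‖ ^ 2 * f t x v))
      (by
        have := hg.continuous
        simp only [Function.uncurry_def]
        fun_prop)
      (fun x v hv => by rw [hs t ht x v hv]; simp)
    simpa only [IntegrableOn, Function.uncurry_apply_pair, integral_const_mul]
      using h.integral_prod_left
  have hm3 : IntegrableOn (fun x => ∫ v, ‖v‖ ^ 3 * f t x v) cube3 := hI3.integral_prod_left
  have hineq : ∫ x in cube3, -∫ v, ‖v‖ ^ 3 * V x v
      ≤ 3 * σ * (∫ x in cube3, ‖u t x‖ * ∫ v, ‖v‖ ^ 2 * f t x v)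
        - 3 * ∫ x in cube3, ∫ v, ‖v‖ ^ 3 * f t x v := by
    rw [← integral_const_mul, ← integral_const_mul,
      ← integral_sub (hm2.const_mul _) (hm3.const_mul _)]
    refine integral_mono (Integrable.neg hIV.integral_prod_left)
      ((hm2.const_mul _).sub (hm3.const_mul _)) fun x => ?_
    have h := neg_integral_norm_pow_three_mul_div_le (hgv x) (hf_nonneg t ht x) (hs t ht x)
      (σ • u t x)
    rw [norm_smul, Real.norm_of_nonneg hσ.le] at h
    refine h.trans_eq ?_
    ring
  have hc : (0 : ℝ) ≤ ((2 * π) ^ 3)⁻¹ * ε⁻¹ := by positivity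
  have := mul_le_mul_of_nonneg_left hineq hc
  simp only [intT3]
  rw [hsplit]
  simp only [div_eq_mul_inv]
  linarith
end
end

section
/- Straightening change of variables in velocity (Lemma 3.12): let c* > 0 satisfy c* e^{c*} < 1/9, let ε, σ > 0, t > 0, let u: [0,t]×ℝ³ → ℝ³ be continuous and C¹ in the space variable with s ↦ sup_{y∈ℝ³} ‖Dₓu(s,y)‖ integrable on [0,t] and ∫₀ᵗ sup_{y∈ℝ³} ‖Dₓu(s,y)‖ ds ≤ c*, and fix x ∈ ℝ³. Under the characteristic flow hypotheses below, the map Γ: v ↦ V(0,v) is a C¹-diffeomorphism from ℝ³ onto itself, and det D_vΓ(v) ≥ e^{3t/ε}/2 for every v ∈ ℝ³. -/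
noncomputable section

open MeasureTheory Real

/-- A `C¹` self-map of a Banach space whose derivative stays at distance at most `c < 1` from the
identity has a global `C¹` inverse. -/
theorem exists_contDiff_inverse_of_norm_fderiv_sub_id_le {E : Type*} [NormedAddCommGroup E]
    [NormedSpace ℝ E] [CompleteSpace E] {f : E → E} {c : ℝ} (hc : c < 1) (hf : ContDiff ℝ 1 f)
    (hbound : ∀ v, ‖fderiv ℝ f v - ContinuousLinearMap.id ℝ E‖ ≤ c) :
    ∃ g : E → E, ContDiff ℝ 1 g ∧ Function.LeftInverse g f ∧ Function.RightInverse g f := by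
  have hc0 : 0 ≤ c := (norm_nonneg _).trans (hbound 0)
  have hdiff : Differentiable ℝ f := hf.differentiable one_ne_zero
  have happrox : ApproximatesLinearOn f
      ((ContinuousLinearEquiv.refl ℝ E : E ≃L[ℝ] E) : E →L[ℝ] E) Set.univ (⟨c, hc0⟩ : NNReal) :=
    fun a _ b _ ↦ convex_univ.norm_image_sub_le_of_norm_fderiv_le' (𝕜 := ℝ)
      (fun y _ ↦ hdiff y) (fun y _ ↦ hbound y) (Set.mem_univ b) (Set.mem_univ a)
  have hc' : Subsingleton E ∨ (⟨c, hc0⟩ : NNReal) <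
      ‖((ContinuousLinearEquiv.refl ℝ E).symm : E →L[ℝ] E)‖₊⁻¹ := by
    rcases subsingleton_or_nontrivial E with h | h
    · exact Or.inl h
    · right
      have : ‖((ContinuousLinearEquiv.refl ℝ E).symm : E →L[ℝ] E)‖₊ = 1 :=
        NNReal.eq (ContinuousLinearMap.norm_id (𝕜 := ℝ) (E := E))
      rw [this, inv_one]
      exact hc
  have hlt (a : E) : ‖ContinuousLinearMap.id ℝ E - fderiv ℝ f a‖ < 1 := by
    rw [norm_sub_rev]
    exact (hbound a).trans_lt hc
  let Φ : E ≃ₜ E := happrox.toHomeomorph f hc'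
  have hΦ : ContDiff ℝ 1 Φ.symm := by
    refine Φ.contDiff_symm
      (f₀' := fun a ↦ ContinuousLinearEquiv.unitsEquiv ℝ E (Units.oneSub _ (hlt a)))
      (fun a ↦ ?_) hf
    have : ((ContinuousLinearEquiv.unitsEquiv ℝ E (Units.oneSub _ (hlt a)) : E ≃L[ℝ] E) :
        E →L[ℝ] E) = fderiv ℝ f a := by
      ext y
      simp
    rw [this]
    exact (hdiff a).hasFDerivAt
  exact ⟨Φ.symm, hΦ, Φ.symm_apply_apply, Φ.apply_symm_apply⟩

/-- A linear perturbation of the identity of `ℝ³` of size at most `1/8` has determinant at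
least `1/2`. -/
theorem half_le_det_of_norm_sub_id_le (L : E3 →L[ℝ] E3)
    (hL : ‖L - ContinuousLinearMap.id ℝ E3‖ ≤ 1 / 8) : 1 / 2 ≤ L.det := by
  set b := EuclideanSpace.basisFun (Fin 3) ℝ
  set A := LinearMap.toMatrix b.toBasis b.toBasis (L : E3 →ₗ[ℝ] E3)
  have hdet : L.det = A.det := (LinearMap.det_toMatrix b.toBasis _).symm
  have hentry (i j : Fin 3) : |A i j - if i = j then 1 else 0| ≤ 1 / 8 := by
    have h1 : A i j - (if i = j then 1 else 0) =
        ((L - ContinuousLinearMap.id ℝ E3) (EuclideanSpace.single j 1)) i := by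
      simp [A, b, LinearMap.toMatrix_apply]
    rw [h1, ← Real.norm_eq_abs]
    calc _ ≤ ‖(L - ContinuousLinearMap.id ℝ E3) (EuclideanSpace.single j 1)‖ :=
          PiLp.norm_apply_le _ i
      _ ≤ ‖L - ContinuousLinearMap.id ℝ E3‖ * ‖(EuclideanSpace.single j 1 : E3)‖ :=
          ContinuousLinearMap.le_opNorm _ _
      _ ≤ 1 / 8 := by simpa using hL
  have hdiag (i : Fin 3) : 7 / 8 ≤ A i i ∧ |A i i| ≤ 9 / 8 := by
    have := abs_le.1 (hentry i i)
    simp only [if_true] at this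
    exact ⟨by linarith, abs_le.2 ⟨by linarith, by linarith⟩⟩
  have hoff (i j : Fin 3) (hij : i ≠ j) : |A i j| ≤ 1 / 8 := by simpa [hij] using hentry i j
  have hmul {x y z p q r : ℝ} (hx : |x| ≤ p) (hy : |y| ≤ q) (hz : |z| ≤ r) :
      |x * y * z| ≤ p * q * r := by
    have := (abs_nonneg x).trans hx
    have := (abs_nonneg y).trans hy
    rw [abs_mul, abs_mul]
    gcongr
  have h0 : (7 / 8 : ℝ) * (7 / 8) * (7 / 8) ≤ A 0 0 * A 1 1 * A 2 2 := by
    have h00 := (hdiag 0).1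
    have h11 := (hdiag 1).1
    have h22 := (hdiag 2).1
    have : 0 ≤ A 0 0 * A 1 1 := mul_nonneg (by linarith) (by linarith)
    gcongr
  have h1 := abs_le.1 (hmul (hdiag 0).2 (hoff 1 2 (by decide)) (hoff 2 1 (by decide)))
  have h2 := abs_le.1 (hmul (hoff 0 1 (by decide)) (hoff 1 0 (by decide)) (hdiag 2).2)
  have h3 := abs_le.1 (hmul (hoff 0 1 (by decide)) (hoff 1 2 (by decide)) (hoff 2 0 (by decide)))
  have h4 := abs_le.1 (hmul (hoff 0 2 (by decide)) (hoff 1 0 (by decide)) (hoff 2 1 (by decide)))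
  have h5 := abs_le.1 (hmul (hoff 0 2 (by decide)) (hdiag 1).2 (hoff 2 0 (by decide)))
  rw [hdet, Matrix.det_fin_three]
  linarith [h1.2, h2.2, h3.1, h4.1, h5.2]

/-- Solutions of a damped linear second-order system with terminal data `A t = 0`: after removing
the damping factor, `B` moves over `[0, t]` by at most `c / (1 - c) * ‖B t‖`, where `c` bounds the
integral of the forcing rate `φ`. -/
theorem norm_exp_smul_sub_le_of_damped_system {F : Type*} [NormedAddCommGroup F] [NormedSpace ℝ F]
    {c ε σ t : ℝ} (hc : c < 1) (hε : 0 < ε) (hσ : 0 < σ) (ht : 0 ≤ t) {A B R : ℝ → F} {φ : ℝ → ℝ}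
    (hA : ∀ s ∈ Set.Icc 0 t, HasDerivWithinAt A (σ⁻¹ • B s) (Set.Icc 0 t) s)
    (hB : ∀ s ∈ Set.Icc 0 t, HasDerivWithinAt B (ε⁻¹ • (σ • R s - B s)) (Set.Icc 0 t) s)
    (hR : ∀ s ∈ Set.Icc 0 t, ‖R s‖ ≤ φ s * ‖A s‖) (hAt : A t = 0)
    (hφ0 : ∀ s, 0 ≤ φ s) (hφ : IntervalIntegrable φ volume 0 t) (hφc : ∫ s in (0:ℝ)..t, φ s ≤ c) :
    ‖Real.exp (-(t / ε)) • B 0 - B t‖ ≤ c / (1 - c) * ‖B t‖ := by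
  set W : ℝ → F := fun s ↦ Real.exp ((s - t) / ε) • B s with hW
  have hWt : W t = B t := by simp [hW]
  have hW0 : W 0 = Real.exp (-(t / ε)) • B 0 := by simp [hW, neg_div]
  have hWd : ∀ s ∈ Set.Icc 0 t, HasDerivWithinAt W
      ((Real.exp ((s - t) / ε) * ε⁻¹ * σ) • R s) (Set.Icc 0 t) s := by
    intro s hs
    have he : HasDerivWithinAt (fun s ↦ Real.exp ((s - t) / ε))
        (Real.exp ((s - t) / ε) * (1 / ε)) (Set.Icc 0 t) s :=
      ((((hasDerivAt_id s).sub_const t).div_const ε).exp).hasDerivWithinAt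
    refine (he.smul (hB s hs)).congr_deriv ?_
    module
  have hWcont : ContinuousOn W (Set.Icc 0 t) := fun s hs ↦ (hWd s hs).continuousWithinAt
  obtain ⟨s₀, hs₀, hmax⟩ := isCompact_Icc.exists_isMaxOn ⟨t, Set.right_mem_Icc.2 ht⟩ hWcont.norm
  set M := ‖W s₀‖
  have hM : ∀ s ∈ Set.Icc 0 t, ‖W s‖ ≤ M := hmax
  have hM0 : 0 ≤ M := norm_nonneg _
  have hnhds {s r : ℝ} (hs : s ∈ Set.Icc 0 t) (hr : r ∈ Set.Ioo s t) : Set.Icc 0 t ∈ nhds r :=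
    Icc_mem_nhds (hs.1.trans_lt hr.1) hr.2
  have hmem {s r : ℝ} (hs : s ∈ Set.Icc 0 t) (hr : r ∈ Set.Ioo s t) : r ∈ Set.Icc 0 t :=
    ⟨hs.1.trans hr.1.le, hr.2.le⟩
  have hBW (s : ℝ) : ‖B s‖ = Real.exp ((t - s) / ε) * ‖W s‖ := by
    have : B s = Real.exp ((t - s) / ε) • W s := by
      rw [hW, smul_smul, ← Real.exp_add, ← add_div]
      simp
    rw [this, norm_smul, Real.norm_of_nonneg (Real.exp_pos _).le]
  have hAbound : ∀ s ∈ Set.Icc 0 t, Real.exp ((s - t) / ε) * ‖A s‖ ≤ M * ε / σ := by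
    intro s hs
    have key := norm_sub_le_integral_of_norm_deriv_le_of_le (f := A)
      (B := fun r ↦ M / σ * Real.exp ((t - r) / ε)) hs.2
      (fun r hr ↦ ((hA r ⟨hs.1.trans hr.1, hr.2⟩).continuousWithinAt.mono
        (Set.Icc_subset_Icc_left hs.1)))
      (fun r hr ↦ ((hA r (hmem hs hr)).hasDerivAt
        (hnhds hs hr)).differentiableAt.differentiableWithinAt)
      (.of_forall fun r hr ↦ by
        rw [((hA r (hmem hs hr)).hasDerivAt (hnhds hs hr)).deriv, norm_smul, hBW,
          Real.norm_of_nonneg (inv_pos.2 hσ).le]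
        calc _ ≤ σ⁻¹ * (Real.exp ((t - r) / ε) * M) := by
              gcongr
              exact hM r (hmem hs hr)
          _ = _ := by ring)
      (Continuous.intervalIntegrable (by fun_prop) _ _)
    have hint : ∫ r in s..t, M / σ * Real.exp ((t - r) / ε) =
        M * ε / σ * (Real.exp ((t - s) / ε) - 1) := by
      have hd : ∀ r ∈ Set.uIcc s t, HasDerivAt (fun r ↦ -(M * ε / σ * Real.exp ((t - r) / ε)))
          (M / σ * Real.exp ((t - r) / ε)) r := by
        intro r _
        refine ((((((hasDerivAt_id r).const_sub t).div_const ε).exp).const_mul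
          (M * ε / σ)).neg).congr_deriv ?_
        simp only [id]
        field_simp
      rw [intervalIntegral.integral_eq_sub_of_hasDerivAt hd
        (Continuous.intervalIntegrable (by fun_prop) _ _)]
      simp
      ring
    rw [hint, hAt, zero_sub, norm_neg] at key
    have hC : 0 ≤ M * ε / σ := by positivity
    calc Real.exp ((s - t) / ε) * ‖A s‖
        ≤ Real.exp ((s - t) / ε) * (M * ε / σ * Real.exp ((t - s) / ε)) := by
          gcongr
          linarith
      _ = M * ε / σ * Real.exp ((s - t) / ε + (t - s) / ε) := by rw [Real.exp_add]; ring
      _ = M * ε / σ := by rw [← add_div]; simp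
  have hdist : ∀ s ∈ Set.Icc 0 t, ‖W s - W t‖ ≤ c * M := by
    intro s hs
    have hsub : Set.uIcc s t ⊆ Set.uIcc 0 t := by
      rw [Set.uIcc_of_le hs.2, Set.uIcc_of_le ht]
      exact Set.Icc_subset_Icc_left hs.1
    have key := norm_sub_le_integral_of_norm_deriv_le_of_le (f := W)
      (B := fun r ↦ φ r * M) hs.2 (hWcont.mono (Set.Icc_subset_Icc_left hs.1))
      (fun r hr ↦ ((hWd r (hmem hs hr)).hasDerivAt
        (hnhds hs hr)).differentiableAt.differentiableWithinAt)
      (.of_forall fun r hr ↦ by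
        rw [((hWd r (hmem hs hr)).hasDerivAt (hnhds hs hr)).deriv, norm_smul,
          Real.norm_of_nonneg (by positivity)]
        calc _ ≤ Real.exp ((r - t) / ε) * ε⁻¹ * σ * (φ r * ‖A r‖) := by
              gcongr
              exact hR r (hmem hs hr)
          _ = φ r * (ε⁻¹ * σ * (Real.exp ((r - t) / ε) * ‖A r‖)) := by ring
          _ ≤ φ r * (ε⁻¹ * σ * (M * ε / σ)) := by
              have := hφ0 r
              gcongr
              exact hAbound r (hmem hs hr)
          _ = φ r * M := by field_simp)
      ((hφ.mono_set hsub).mul_const M)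
    rw [intervalIntegral.integral_mul_const, norm_sub_rev] at key
    refine key.trans (mul_le_mul_of_nonneg_right (le_trans ?_ hφc) hM0)
    exact intervalIntegral.integral_mono_interval hs.1 hs.2 le_rfl (.of_forall hφ0) hφ
  have hc0 : 0 ≤ c := (intervalIntegral.integral_nonneg ht fun s _ ↦ hφ0 s).trans hφc
  have hMle : M ≤ ‖B t‖ / (1 - c) := by
    rw [le_div_iff₀ (by linarith)]
    have h1 := norm_sub_norm_le (W s₀) (W t)
    have h2 := hdist s₀ hs₀
    rw [hWt] at h1 h2
    linarith
  rw [← hW0, ← hWt]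
  calc ‖W 0 - W t‖ ≤ c * M := hdist 0 (Set.left_mem_Icc.2 ht)
    _ ≤ c * (‖B t‖ / (1 - c)) := by gcongr
    _ = c / (1 - c) * ‖W t‖ := by rw [hWt]; ring

/-- **Straightening change of variables in velocity** (Statement 10, Lemma 3.12).
Let `c* > 0` with `c* e^{c*} < 1/9`, let `ε, σ > 0`, `t > 0`, let `u` be continuous on
`[0,t]×ℝ³` and `C¹` in the space variable with `∫₀ᵗ sup_y ‖Dₓu(s,y)‖ ds ≤ c*`, and fix
`x ∈ ℝ³`.  Given backward characteristics `X, V` (with terminal data `X(t,v) = x`,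
`V(t,v) = v`), which are `C¹` in `v` with jointly continuous velocity-Jacobians solving
the linearized system, the map `Γ : v ↦ V(0,v)` is a `C¹`-diffeomorphism of `ℝ³` onto
itself and `det D_vΓ(v) ≥ e^{3t/ε}/2` for every `v`. -/
theorem straightening_change_of_variables
    (cstar ε σ t : ℝ) (hcstar : 0 < cstar) (hsmall : cstar * Real.exp cstar < 1 / 9)
    (hε : 0 < ε) (hσ : 0 < σ) (ht : 0 < t)
    (u : ℝ → E3 → E3)
    -- `u` is continuous on `[0,t] × ℝ³`
    (hu_cont : ContinuousOn (fun q : ℝ × E3 => u q.1 q.2) (Set.Icc 0 t ×ˢ Set.univ))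
    -- `u` is `C¹` in the space variable
    (hu_x : ∀ s ∈ Set.Icc (0:ℝ) t, ContDiff ℝ 1 (u s))
    -- the map `s ↦ sup_y ‖Dₓu(s,y)‖` is (well-defined and) integrable on `[0,t]`
    (hu_bdd : ∀ s ∈ Set.Icc (0:ℝ) t,
      BddAbove (Set.range fun y : E3 => ‖fderiv ℝ (u s) y‖))
    (hu_int : IntegrableOn (fun s => ⨆ y : E3, ‖fderiv ℝ (u s) y‖) (Set.Icc 0 t))
    -- `∫₀ᵗ sup_y ‖Dₓu(s,y)‖ ds ≤ c*`
    (hu_small : ∫ s in (0:ℝ)..t, (⨆ y : E3, ‖fderiv ℝ (u s) y‖) ≤ cstar)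
    (x : E3) (X V : ℝ → E3 → E3)
    -- (i) characteristic ODEs with terminal conditions at time `t`
    (hode : ∀ v : E3, ∀ s ∈ Set.Icc (0:ℝ) t,
      HasDerivWithinAt (fun s' => X s' v) (σ⁻¹ • V s v) (Set.Icc 0 t) s ∧
      HasDerivWithinAt (fun s' => V s' v) (ε⁻¹ • (σ • u s (X s v) - V s v))
        (Set.Icc 0 t) s)
    (hterm : ∀ v : E3, X t v = x ∧ V t v = v)
    -- (ii) `C¹` dependence on `v`, with jointly continuous velocity-Jacobians
    (hreg : ∀ s ∈ Set.Icc (0:ℝ) t, ContDiff ℝ 1 (X s) ∧ ContDiff ℝ 1 (V s))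
    (hjac_cont : ContinuousOn
      (fun q : ℝ × E3 => (fderiv ℝ (X q.1) q.2, fderiv ℝ (V q.1) q.2))
      (Set.Icc 0 t ×ˢ Set.univ))
    -- (iii) the velocity-Jacobians solve the linearized characteristic system
    (hlin : ∀ v : E3, ∀ s ∈ Set.Icc (0:ℝ) t,
      HasDerivWithinAt (fun s' => fderiv ℝ (X s') v) (σ⁻¹ • fderiv ℝ (V s) v)
        (Set.Icc 0 t) s ∧
      HasDerivWithinAt (fun s' => fderiv ℝ (V s') v)
        (ε⁻¹ • (σ • ((fderiv ℝ (u s) (X s v)).comp (fderiv ℝ (X s) v))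
          - fderiv ℝ (V s) v)) (Set.Icc 0 t) s) :
    (∃ g : E3 → E3,
      ContDiff ℝ 1 (V 0) ∧ ContDiff ℝ 1 g ∧
      Function.LeftInverse g (V 0) ∧ Function.RightInverse g (V 0))
    ∧ ∀ v : E3, Real.exp (3 * t / ε) / 2 ≤ (fderiv ℝ (V 0) v).det := by
  have hφ0 (s : ℝ) : 0 ≤ ⨆ y : E3, ‖fderiv ℝ (u s) y‖ := Real.iSup_nonneg fun _ ↦ norm_nonneg _
  have hc : cstar < 1 / 9 := by
    nlinarith [mul_le_mul_of_nonneg_left (Real.one_le_exp hcstar.le) hcstar.le]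
  have ht_mem : t ∈ Set.Icc 0 t := Set.right_mem_Icc.2 ht.le
  have h0_mem : (0 : ℝ) ∈ Set.Icc 0 t := Set.left_mem_Icc.2 ht.le
  have hXt (v : E3) : fderiv ℝ (X t) v = 0 := by
    rw [show X t = fun _ ↦ x from funext fun w ↦ (hterm w).1]
    simp
  have hVt (v : E3) : fderiv ℝ (V t) v = ContinuousLinearMap.id ℝ E3 := by
    rw [show V t = id from funext fun w ↦ (hterm w).2]
    exact fderiv_id
  have hclose (v : E3) :
      ‖Real.exp (-(t / ε)) • fderiv ℝ (V 0) v - ContinuousLinearMap.id ℝ E3‖ ≤ 1 / 8 := by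
    have h := norm_exp_smul_sub_le_of_damped_system (by linarith) hε hσ ht.le
      (A := fun s ↦ fderiv ℝ (X s) v) (B := fun s ↦ fderiv ℝ (V s) v)
      (R := fun s ↦ (fderiv ℝ (u s) (X s v)).comp (fderiv ℝ (X s) v))
      (fun s hs ↦ (hlin v s hs).1) (fun s hs ↦ (hlin v s hs).2)
      (fun s hs ↦ (ContinuousLinearMap.opNorm_comp_le _ _).trans
        (mul_le_mul_of_nonneg_right (le_ciSup (hu_bdd s hs) (X s v)) (norm_nonneg _)))
      (hXt v) hφ0
      ((intervalIntegrable_iff_integrableOn_Icc_of_le ht.le).2 hu_int) hu_small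
    simp only [hVt] at h
    refine h.trans ?_
    rw [ContinuousLinearMap.norm_id, mul_one, div_le_iff₀ (by linarith)]
    linarith
  have hV : ContDiff ℝ 1 (V 0) := (hreg 0 h0_mem).2
  have hfd (v : E3) : fderiv ℝ (fun w ↦ Real.exp (-(t / ε)) • V 0 w) v =
      Real.exp (-(t / ε)) • fderiv ℝ (V 0) v :=
    fderiv_fun_const_smul (hV.differentiable one_ne_zero v) _
  have hexp : Real.exp (t / ε) * Real.exp (-(t / ε)) = 1 := by
    rw [← Real.exp_add]
    simp
  constructor
  · obtain ⟨g, hg, hleft, hright⟩ := exists_contDiff_inverse_of_norm_fderiv_sub_id_le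
      (f := fun w ↦ Real.exp (-(t / ε)) • V 0 w) (c := 1 / 8) (by norm_num)
      (hV.const_smul _) (fun v ↦ by rw [hfd]; exact hclose v)
    refine ⟨fun y ↦ g (Real.exp (-(t / ε)) • y), hV, hg.comp (contDiff_id.const_smul _),
      hleft, fun y ↦ ?_⟩
    exact smul_right_injective E3 (Real.exp_ne_zero (-(t / ε))) (hright _)
  · intro v
    have hdet := half_le_det_of_norm_sub_id_le _ (hclose v)
    have hsmul : (Real.exp (-(t / ε)) • fderiv ℝ (V 0) v).det =
        Real.exp (-(t / ε)) ^ 3 * (fderiv ℝ (V 0) v).det := by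
      have := LinearMap.det_smul (Real.exp (-(t / ε))) (fderiv ℝ (V 0) v : E3 →ₗ[ℝ] E3)
      rwa [finrank_euclideanSpace_fin] at this
    rw [hsmul] at hdet
    calc Real.exp (3 * t / ε) / 2 = Real.exp (t / ε) ^ 3 * (1 / 2) := by
          rw [← Real.exp_nat_mul]
          push_cast
          ring_nf
      _ ≤ Real.exp (t / ε) ^ 3 * (Real.exp (-(t / ε)) ^ 3 * (fderiv ℝ (V 0) v).det) := by gcongr
      _ = (fderiv ℝ (V 0) v).det := by rw [← mul_assoc, ← mul_pow, hexp, one_pow, one_mul]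
end
end
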